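/- arXiv:1605.02715 — 3 statements merged into one kernel-verified Lean document; each statement's English description precedes it below -/
import Mathlib

section
/- Palm inversion formula: let 𝔓 be a stationary simple point process on ℝ with intensity I ∈ (0,∞), and let Q be its Palm distribution. Then for every measurable f : M(ℝ) → [0,∞], ∫ f(ζ) · 1{ζ ≠ 0} d𝔓(ζ) = I · ∫ (∫_0^{τ₁(η)} f(θ^u η) du) dQ(η), where both sides are taken in [0,∞] and the inner integral is over u ∈ [0, τ₁(η)) ⊆ [0,∞). -/
open MeasureTheory Set Filter
open scoped ENNReal

/-- The shift `θ^u` on Borel measures on `ℝ`: `(θ^u ζ)(B) = ζ(B + u)`. -/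
noncomputable def shift (u : ℝ) (ζ : Measure ℝ) : Measure ℝ :=
  Measure.map (fun t => t - u) ζ

/-- `𝔓` is stationary: the pushforward of `𝔓` under `θ^u` equals `𝔓` for every `u ∈ ℝ`. -/
def IsStationaryPP (P : Measure (Measure ℝ)) : Prop :=
  ∀ u : ℝ, Measure.map (shift u) P = P

/-- `𝔓` is a simple point process: `𝔓`-a.e. `ζ` is `ℕ`-valued on bounded Borel sets and has
no multiple points. -/
def IsSimplePP (P : Measure (Measure ℝ)) : Prop :=
  ∀ᵐ ζ ∂P, (∀ B : Set ℝ, Bornology.IsBounded B → MeasurableSet B → ∃ n : ℕ, ζ B = (n : ℝ≥0∞)) ∧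
    ∀ t : ℝ, ζ ({t} : Set ℝ) ≤ 1

/-- The intensity `I = ∫ ζ((0,1]) d𝔓(ζ)` of a stationary point process. -/
noncomputable def intensity (P : Measure (Measure ℝ)) : ℝ≥0∞ :=
  ∫⁻ ζ, ζ (Set.Ioc (0 : ℝ) 1) ∂P

/-- `Q` is the Palm distribution of `𝔓`:
`∫ f dQ = I⁻¹ ∫ (∫_{(0,1]} f(θ^u ζ) ζ(du)) d𝔓(ζ)` for all measurable `f : M(ℝ) → [0,∞]`. -/
def IsPalm (P Q : Measure (Measure ℝ)) : Prop :=
  ∀ f : Measure ℝ → ℝ≥0∞, Measurable f →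
    ∫⁻ η, f η ∂Q = (intensity P)⁻¹ * ∫⁻ ζ, (∫⁻ u in Set.Ioc (0 : ℝ) 1, f (shift u ζ) ∂ζ) ∂P

/-- `τ_j(ζ) = inf {t > 0 : ζ((0,t]) ≥ j} ∈ (0,∞]` for `j ≥ 1` (with `inf ∅ = ∞`),
and `τ_0(ζ) = 0`. -/
noncomputable def tau (j : ℕ) (ζ : Measure ℝ) : ℝ≥0∞ :=
  if j = 0 then 0
  else sInf ((fun s : ℝ => ENNReal.ofReal s) '' {s : ℝ | 0 < s ∧ (j : ℝ≥0∞) ≤ ζ (Set.Ioc 0 s)})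

open ProbabilityTheory

namespace PalmAux

def LF : Set (Measure ℝ) := {ζ | ∀ n : ℕ, ζ (Icc (-(n:ℝ)) n) < ⊤}

lemma measurableSet_LF : MeasurableSet LF := by
  have : LF = ⋂ n : ℕ, {ζ : Measure ℝ | ζ (Icc (-(n:ℝ)) n) < ⊤} := by
    ext; simp [LF]
  rw [this]
  exact MeasurableSet.iInter fun n =>
    measurableSet_lt (Measure.measurable_coe measurableSet_Icc) measurable_const

lemma LF_lt {ζ : Measure ℝ} (h : ζ ∈ LF) {a b : ℝ} : ζ (Icc a b) < ⊤ := by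
  obtain ⟨n, hn⟩ := exists_nat_ge (max |a| |b|)
  refine lt_of_le_of_lt (measure_mono ?_) (h n)
  have h1 := (abs_le.1 ((le_max_left _ _).trans hn)).1
  have h2 := (abs_le.1 ((le_max_right _ _).trans hn)).2
  exact Icc_subset_Icc h1 h2

lemma shift_apply (u : ℝ) (ζ : Measure ℝ) {B : Set ℝ} (hB : MeasurableSet B) :
    shift u ζ B = ζ ((fun t => t - u) ⁻¹' B) :=
  Measure.map_apply (by fun_prop) hB

lemma measurable_shift (u : ℝ) : Measurable (shift u) :=
  Measure.measurable_map _ (by fun_prop)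

lemma shift_shift (u v : ℝ) (ζ : Measure ℝ) : shift u (shift v ζ) = shift (u + v) ζ := by
  unfold shift
  rw [Measure.map_map (by fun_prop) (by fun_prop)]
  congr 1
  ext t; simp; ring

lemma shift_LF (u : ℝ) {ζ : Measure ℝ} (h : ζ ∈ LF) : shift u ζ ∈ LF := by
  intro n
  rw [shift_apply _ _ measurableSet_Icc]
  simpa using LF_lt h

open Classical in
noncomputable def kapPart (p : ℤ × ℕ) : Kernel (Measure ℝ) ℝ where
  toFun ζ := if ζ (Ioc (p.1:ℝ) (p.1+1)) < (p.2:ℝ≥0∞) + 1 ∧ (p.2:ℝ≥0∞) ≤ ζ (Ioc (p.1:ℝ) (p.1+1)) then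
    ζ.restrict (Ioc (p.1:ℝ) (p.1+1)) else 0
  measurable' := by
    have hm : Measurable fun ζ : Measure ℝ => ζ (Ioc (p.1:ℝ) (p.1+1)) :=
      Measure.measurable_coe measurableSet_Ioc
    refine Measurable.ite ?_ ?_ measurable_const
    swap
    · refine Measure.measurable_of_measurable_coe _ fun B hB => ?_
      simp_rw [Measure.restrict_apply hB]
      exact Measure.measurable_coe (hB.inter measurableSet_Ioc)
    exact (measurableSet_lt hm measurable_const).inter (measurableSet_le measurable_const hm)

instance (p : ℤ × ℕ) : IsFiniteKernel (kapPart p) := by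
  refine ⟨⟨(p.2:ℝ≥0∞)+1, by simp [ENNReal.add_lt_top], fun ζ => ?_⟩⟩
  change (if _ then _ else _ : Measure ℝ) univ ≤ _
  split_ifs with h
  · simpa using h.1.le
  · simp

noncomputable def kap : Kernel (Measure ℝ) ℝ := Kernel.sum kapPart

instance : IsSFiniteKernel kap := by unfold kap; infer_instance

lemma kap_eq {ζ : Measure ℝ} (h : ζ ∈ LF) : kap ζ = ζ := by
  ext B hB
  unfold kap
  rw [Kernel.sum_apply' _ _ hB, ENNReal.tsum_prod']
  have : ∀ n : ℤ, ∑' m : ℕ, kapPart (n, m) ζ B = ζ.restrict (Ioc (n:ℝ) (n+1)) B := by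
    intro n
    have hlt : ζ (Ioc (n:ℝ) (n+1)) < ⊤ := (measure_mono Ioc_subset_Icc_self).trans_lt (LF_lt h)
    set x := (ζ (Ioc (n:ℝ) (n+1))).toNNReal with hx
    have hxe : ζ (Ioc (n:ℝ) (n+1)) = x := (ENNReal.coe_toNNReal hlt.ne).symm
    rw [tsum_eq_single ⌊x⌋₊]
    · change (if _ then _ else _ : Measure ℝ) B = _
      rw [if_pos]
      dsimp only
      rw [hxe]
      exact ⟨by exact_mod_cast Nat.lt_floor_add_one x, by exact_mod_cast Nat.floor_le (zero_le)⟩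
    · intro m hm
      change (if _ then _ else _ : Measure ℝ) B = _
      rw [if_neg]
      · simp
      dsimp only
      rw [hxe]
      rintro ⟨h1, h2⟩
      apply hm
      symm
      rw [Nat.floor_eq_iff zero_le]
      exact ⟨by exact_mod_cast h2, by exact_mod_cast h1⟩
  simp_rw [this]
  rw [← Measure.sum_apply _ hB, ← Measure.restrict_iUnion _ (fun _ => measurableSet_Ioc)]
  · rw [iUnion_Ioc_intCast, Measure.restrict_univ]
  · exact pairwise_disjoint_Ioc_intCast ℝ

/-- jointly measurable version of the shift -/
noncomputable def S (p : ℝ × Measure ℝ) : Measure ℝ := shift p.1 (kap p.2)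

lemma S_eq {ζ : Measure ℝ} (h : ζ ∈ LF) (u : ℝ) : S (u, ζ) = shift u ζ := by
  simp [S, kap_eq h]

lemma measurable_S : Measurable S := by
  refine Measure.measurable_of_measurable_coe _ fun B hB => ?_
  have : (fun p => S p B) = fun p : ℝ × Measure ℝ =>
      (Kernel.prodMkLeft ℝ kap p) (Prod.mk p ⁻¹' {q : (ℝ × Measure ℝ) × ℝ | q.2 - q.1.1 ∈ B}) := by
    ext p
    simp only [S]
    rw [shift_apply _ _ hB]
    rfl
  rw [this]
  refine Kernel.measurable_kernel_prodMk_left ?_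
  exact (by fun_prop : Measurable fun q : (ℝ × Measure ℝ) × ℝ => q.2 - q.1.1) hB

def E : Set (ℝ × Measure ℝ) := {p | 0 ≤ p.1 ∧ ∃ q : ℚ, p.1 < q ∧ p.2 (Ioc 0 (q:ℝ)) < 1}

lemma measurableSet_E : MeasurableSet E := by
  have : E = {p : ℝ × Measure ℝ | 0 ≤ p.1} ∩ ⋃ q : ℚ, ({p | p.1 < q} ∩ {p | p.2 (Ioc 0 (q:ℝ)) < 1}) := by
    ext; simp [E]
  rw [this]
  refine (measurableSet_le measurable_const measurable_fst).inter
    (MeasurableSet.iUnion fun q => (measurableSet_lt measurable_fst measurable_const).inter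
      (measurableSet_lt ?_ measurable_const))
  exact (Measure.measurable_coe measurableSet_Ioc).comp measurable_snd

lemma mem_E_iff (u : ℝ) (η : Measure ℝ) :
    (u, η) ∈ E ↔ 0 ≤ u ∧ ENNReal.ofReal u < tau 1 η := by
  simp only [E, mem_ofPred_eq, tau, one_ne_zero, if_false, Nat.cast_one]
  refine and_congr_right fun hu => ⟨?_, ?_⟩
  · rintro ⟨q, hq, h⟩
    refine lt_of_lt_of_le ((ENNReal.ofReal_lt_ofReal_iff (hu.trans_lt hq)).2 hq) (le_sInf ?_)
    rintro _ ⟨s, ⟨hs, hs'⟩, rfl⟩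
    refine ENNReal.ofReal_le_ofReal ?_
    by_contra! hlt
    exact absurd (hs'.trans (measure_mono (Ioc_subset_Ioc_right hlt.le))) (not_le.2 h)
  · intro h
    obtain ⟨y, hy1, hy2⟩ := exists_between h
    have hyt : y ≠ ⊤ := (hy2.trans_le le_top).ne
    have : u < y.toReal := (ENNReal.ofReal_lt_iff_lt_toReal hu hyt).1 hy1
    obtain ⟨q, hq1, hq2⟩ := exists_rat_btwn this
    refine ⟨q, hq1, ?_⟩
    by_contra! hge
    have h2 := sInf_le (s := ((fun s : ℝ => ENNReal.ofReal s) '' {s : ℝ | 0 < s ∧ 1 ≤ η (Set.Ioc 0 s)}))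
      ⟨(q:ℝ), ⟨hu.trans_lt hq1, hge⟩, rfl⟩
    have h3 := hy2.trans_le h2
    have h4 : ENNReal.ofReal q ≤ y := ENNReal.ofReal_le_of_le_toReal hq2.le
    exact absurd h3 (not_lt.2 h4)

lemma nat_val {ζ : Measure ℝ} 
    (h1 : ∀ B : Set ℝ, Bornology.IsBounded B → MeasurableSet B → ∃ n : ℕ, ζ B = (n : ℝ≥0∞))
    {B : Set ℝ} (hb : Bornology.IsBounded B) (hm : MeasurableSet B) (h : ζ B < 1) : ζ B = 0 := by
  obtain ⟨n, hn⟩ := h1 B hb hm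
  rw [hn] at h ⊢
  have : n < 1 := by exact_mod_cast h
  simp; omega

lemma simple_LF {ζ : Measure ℝ} 
    (h1 : ∀ B : Set ℝ, Bornology.IsBounded B → MeasurableSet B → ∃ n : ℕ, ζ B = (n : ℝ≥0∞)) :
    ζ ∈ LF := by
  intro n
  obtain ⟨m, hm⟩ := h1 _ (Metric.isBounded_Icc (-(n:ℝ)) n) measurableSet_Icc
  rw [hm]; exact ENNReal.natCast_lt_top m

/-- deterministic lemma -/
lemma measure_last {ζ : Measure ℝ}
    (h1 : ∀ B : Set ℝ, Bornology.IsBounded B → MeasurableSet B → ∃ n : ℕ, ζ B = (n : ℝ≥0∞))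
    (h2 : ∀ t : ℝ, ζ ({t} : Set ℝ) ≤ 1) (h0 : ζ (Iic 0) ≠ 0) :
    ζ {v : ℝ | v ≤ 0 ∧ ∃ q : ℚ, -v < q ∧ ζ (Ioc v (v+q)) < 1} = 1 := by
  have hLF := simple_LF h1
  have hex : ∃ n : ℕ, ζ (Icc (-(n:ℝ)) 0) ≠ 0 := by
    by_contra! hall
    apply h0
    have : Iic (0:ℝ) ⊆ ⋃ n : ℕ, Icc (-(n:ℝ)) 0 := by
      intro x hx
      obtain ⟨n, hn⟩ := exists_nat_ge (-x)
      exact mem_iUnion.2 ⟨n, by linarith, hx⟩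
    exact measure_mono_null this (measure_iUnion_null hall)
  obtain ⟨n, hn⟩ := hex
  set T : Set ℝ := {v | v ≤ 0 ∧ ζ (Icc v 0) ≠ 0} with hT
  have hTn : T.Nonempty := ⟨-(n:ℝ), by simp, hn⟩
  have hTb : BddAbove T := ⟨0, fun v hv => hv.1⟩
  set v0 := sSup T with hv0
  have hv0le : v0 ≤ 0 := csSup_le hTn fun v hv => hv.1
  have hgt : ∀ v, v0 < v → ζ (Icc v 0) = 0 := by
    intro v hv
    by_cases hv' : v ≤ 0
    · by_contra hne
      exact absurd (le_csSup hTb (show v ∈ T from ⟨hv', hne⟩)) (not_le.2 hv)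
    · rw [Icc_eq_empty hv']; simp
  have hIoc : ζ (Ioc v0 0) = 0 := by
    have : Ioc v0 0 ⊆ ⋃ n : ℕ, Icc (v0 + 1/((n:ℝ)+1)) 0 := by
      intro x hx
      obtain ⟨n, hn⟩ := exists_nat_one_div_lt (sub_pos.2 hx.1)
      exact mem_iUnion.2 ⟨n, by linarith, hx.2⟩
    refine measure_mono_null this (measure_iUnion_null fun n => hgt _ ?_)
    have : (0:ℝ) < 1/((n:ℝ)+1) := by positivity
    linarith
  have hlt : ∀ v, v < v0 → 1 ≤ ζ (Icc v 0) := by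
    intro v hv
    obtain ⟨w, hw, hvw⟩ := exists_lt_of_lt_csSup hTn hv
    by_contra! hlt
    exact hw.2 (measure_mono_null (Icc_subset_Icc_left hvw.le)
      (nat_val h1 (Metric.isBounded_Icc _ _) measurableSet_Icc hlt))
  have hat : ζ {v0} = 1 := by
    refine le_antisymm (h2 _) ?_
    have hseq : ⋂ n : ℕ, Icc (v0 - 1/((n:ℝ)+1)) v0 = {v0} := by
      ext x
      simp only [mem_iInter, mem_Icc, mem_singleton_iff]
      constructor
      · intro h
        refine le_antisymm (h 0).2 ?_
        by_contra! hx
        obtain ⟨n, hn⟩ := exists_nat_one_div_lt (sub_pos.2 hx)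
        linarith [(h n).1]
      · rintro rfl n
        have : (0:ℝ) < 1/((n:ℝ)+1) := by positivity
        exact ⟨by linarith, le_rfl⟩
    rw [← hseq, Antitone.measure_iInter]
    · refine le_iInf fun n => ?_
      have hp : (0:ℝ) < 1/((n:ℝ)+1) := by positivity
      have := hlt (v0 - 1/((n:ℝ)+1)) (by linarith)
      rw [← Icc_union_Ioc_eq_Icc (b := v0) (by linarith) hv0le] at this
      exact (this.trans (measure_union_le _ _)).trans (by simp [hIoc])
    · intro a b hab
      refine Icc_subset_Icc_left ?_
      have := Nat.one_div_le_one_div (α := ℝ) hab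
      linarith
    · exact fun _ => measurableSet_Icc.nullMeasurableSet
    · exact ⟨0, (LF_lt hLF).ne⟩
  have hr : ∃ e : ℝ, 0 < e ∧ ζ (Ioc 0 e) = 0 := by
    by_contra! hall
    have hseq : ⋂ n : ℕ, Ioc (0:ℝ) (1/((n:ℝ)+1)) = ∅ := by
      ext x
      simp only [mem_iInter, mem_Ioc, mem_empty_iff_false, iff_false]
      intro h
      obtain ⟨n, hn⟩ := exists_nat_one_div_lt (h 0).1
      linarith [(h n).2]
    have h3 : ζ (⋂ n : ℕ, Ioc (0:ℝ) (1/((n:ℝ)+1))) = ⨅ n : ℕ, ζ (Ioc (0:ℝ) (1/((n:ℝ)+1))) := by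
      refine Antitone.measure_iInter ?_ (fun _ => measurableSet_Ioc.nullMeasurableSet)
        ⟨0, ((measure_mono Ioc_subset_Icc_self).trans_lt (LF_lt hLF)).ne⟩
      intro a b hab
      exact Ioc_subset_Ioc_right (Nat.one_div_le_one_div (α := ℝ) hab)
    rw [hseq, measure_empty] at h3
    have : (1:ℝ≥0∞) ≤ 0 := by
      rw [h3]
      refine le_iInf fun n => ?_
      by_contra! hlt
      exact hall _ (by positivity) (nat_val h1 (Metric.isBounded_Ioc _ _) measurableSet_Ioc hlt)
    simp at this
  obtain ⟨e, he, hze⟩ := hr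
  apply le_antisymm
  · have hsub : {v : ℝ | v ≤ 0 ∧ ∃ q : ℚ, -v < q ∧ ζ (Ioc v (v+q)) < 1} ⊆ {v0} ∪ Ioc v0 0 := by
      rintro v ⟨hv, q, hq, hlt'⟩
      rcases lt_trichotomy v v0 with h | h | h
      · exfalso
        have : ζ {v0} ≤ ζ (Ioc v (v+q)) := measure_mono (by
          rw [singleton_subset_iff]; exact ⟨h, by linarith⟩)
        rw [hat] at this
        exact absurd this (not_le.2 hlt')
      · left; exact h
      · right; exact ⟨h, hv⟩
    refine (measure_mono hsub).trans ((measure_union_le _ _).trans ?_)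
    simp [hIoc, hat]
  · rw [← hat]
    refine measure_mono ?_
    rw [singleton_subset_iff]
    obtain ⟨q, hq1, hq2⟩ := exists_rat_btwn (show -v0 < -v0 + e by linarith)
    refine ⟨hv0le, q, hq1, ?_⟩
    have : ζ (Ioc v0 (v0+q)) = 0 := by
      refine measure_mono_null (t := Ioc v0 0 ∪ Ioc 0 e) ?_ (measure_union_null hIoc hze)
      rintro x ⟨hx1, hx2⟩
      by_cases hx : x ≤ 0
      · left; exact ⟨hx1, hx⟩
      · right; exact ⟨not_le.1 hx, by linarith⟩
    simp [this, hat]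

/-- recurrence -/
lemma ae_recur (P : Measure (Measure ℝ)) [IsProbabilityMeasure P] (hstat : IsStationaryPP P) :
    ∀ᵐ ζ ∂P, ζ ≠ 0 → ζ (Iic (0:ℝ)) ≠ 0 := by
  set A : ℕ → Set (Measure ℝ) := fun n => {ζ | ζ (Iic (n:ℝ)) = 0} with hA
  have hAm : ∀ n, MeasurableSet (A n) := fun n =>
    (Measure.measurable_coe measurableSet_Iic) (measurableSet_singleton 0)
  have hPA : ∀ n, P (A n) = P (A 0) := by
    intro n
    conv_rhs => rw [← hstat n, Measure.map_apply (measurable_shift _) (hAm 0)]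
    congr 1
    ext ζ
    simp [hA, shift_apply _ _ measurableSet_Iic]
  have hint : ⋂ n, A n = {0} := by
    ext ζ
    simp only [hA, mem_iInter, mem_ofPred_eq, mem_singleton_iff]
    constructor
    · intro h
      rw [← Measure.measure_univ_eq_zero]
      have : (univ : Set ℝ) ⊆ ⋃ n : ℕ, Iic (n:ℝ) := fun x _ => by
        obtain ⟨n, hn⟩ := exists_nat_ge x
        exact mem_iUnion.2 ⟨n, hn⟩
      exact measure_mono_null this (measure_iUnion_null h)
    · rintro rfl; simp
  have hanti : Antitone A := by
    intro a b hab ζ hζ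
    exact measure_mono_null (Iic_subset_Iic.2 (by exact_mod_cast hab)) hζ
  have h1 : P (⋂ n, A n) = P (A 0) := by
    rw [hanti.measure_iInter (fun n => (hAm n).nullMeasurableSet) ⟨0, measure_ne_top _ _⟩]
    simp [hPA]
  have hsub : ⋂ n, A n ⊆ A 0 := iInter_subset _ _
  have h2 : P (A 0 \ ⋂ n, A n) = 0 := by
    rw [measure_sdiff hsub (MeasurableSet.iInter hAm).nullMeasurableSet (measure_ne_top _ _), h1]
    simp
  rw [ae_iff]
  refine measure_mono_null ?_ h2
  intro ζ hζ
  simp only [mem_ofPred_eq, Classical.not_imp, not_not] at hζ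
  rw [hint]
  exact ⟨by simpa [hA] using hζ.2, hζ.1⟩

/-- `(v, ζ)` such that `v ≤ 0` and the first point of `ζ` after `v` is positive. -/
def D : Set (ℝ × Measure ℝ) := {p | (-p.1, S p) ∈ E}

lemma measurableSet_D : MeasurableSet D :=
  (measurable_fst.neg.prodMk measurable_S) measurableSet_E

lemma mem_D_iff {ζ : Measure ℝ} (h : ζ ∈ LF) (v : ℝ) :
    (v, ζ) ∈ D ↔ v ≤ 0 ∧ ∃ q : ℚ, -v < q ∧ ζ (Ioc v (v+q)) < 1 := by
  simp only [D, E, mem_ofPred_eq, S_eq h, shift_apply _ _ measurableSet_Ioc, Left.nonneg_neg_iff,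
    preimage_sub_const_Ioc, zero_add, add_comm, add_zero]

lemma mem_D_shift {ζ : Measure ℝ} (h : ζ ∈ LF) (v w : ℝ) :
    (v - w, shift w ζ) ∈ D ↔ (w - v, shift v ζ) ∈ E := by
  simp only [D, mem_ofPred_eq, S_eq (shift_LF w h), shift_shift, neg_sub, sub_add_cancel]

/-- the function of two variables in the exchange argument -/
noncomputable def Phi (f : Measure ℝ → ℝ≥0∞) (p : ℝ × Measure ℝ) : ℝ≥0∞ :=
  ∫⁻ v, (Ioc (0:ℝ) 1).indicator 1 (v + p.1) * (D.indicator 1 (v, p.2) * f p.2) ∂(kap p.2)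

lemma measurable_PhiIntegrand {f : Measure ℝ → ℝ≥0∞} (hf : Measurable f) :
    Measurable fun q : (ℝ × Measure ℝ) × ℝ =>
      (Ioc (0:ℝ) 1).indicator (1 : ℝ → ℝ≥0∞) (q.2 + q.1.1) *
        (D.indicator (1 : ℝ × Measure ℝ → ℝ≥0∞) (q.2, q.1.2) * f q.1.2) := by
  have h1 : Measurable ((Ioc (0:ℝ) 1).indicator (1 : ℝ → ℝ≥0∞)) :=
    measurable_one.indicator measurableSet_Ioc
  have h2 : Measurable (D.indicator (1 : ℝ × Measure ℝ → ℝ≥0∞)) :=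
    measurable_one.indicator measurableSet_D
  refine (h1.comp (by fun_prop)).mul ((h2.comp ?_).mul (hf.comp (by fun_prop)))
  fun_prop

lemma measurable_Phi {f : Measure ℝ → ℝ≥0∞} (hf : Measurable f) : Measurable (Phi f) := by
  have := Measurable.lintegral_kernel_prod_right' (κ := Kernel.prodMkLeft ℝ kap)
    (measurable_PhiIntegrand hf)
  exact this

/-- integrating out `w` -/
lemma lintegral_Phi {f : Measure ℝ → ℝ≥0∞} (hf : Measurable f) (ζ : Measure ℝ) :
    ∫⁻ w, Phi f (w, ζ) = kap ζ {v | (v, ζ) ∈ D} * f ζ := by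
  unfold Phi
  have hD : MeasurableSet {v : ℝ | (v, ζ) ∈ D} := measurable_prodMk_right measurableSet_D
  dsimp only
  rw [lintegral_lintegral_swap]
  · have : ∀ v : ℝ, ∫⁻ w, (Ioc (0:ℝ) 1).indicator (1 : ℝ → ℝ≥0∞) (v + w) *
        (D.indicator (1 : ℝ × Measure ℝ → ℝ≥0∞) (v, ζ) * f ζ)
        = {v | (v, ζ) ∈ D}.indicator (1 : ℝ → ℝ≥0∞) v * f ζ := by
      intro v
      have h1 : Measurable ((Ioc (0:ℝ) 1).indicator (1 : ℝ → ℝ≥0∞)) :=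
        measurable_one.indicator measurableSet_Ioc
      rw [lintegral_mul_const _ (show Measurable fun w => (Ioc (0:ℝ) 1).indicator (1 : ℝ → ℝ≥0∞) (v + w)
          from h1.comp (measurable_const_add v)),
        lintegral_add_left_eq_self (fun w => (Ioc (0:ℝ) 1).indicator (1 : ℝ → ℝ≥0∞) w) v,
        lintegral_indicator_one measurableSet_Ioc]
      simp [indicator]
    simp_rw [this]
    rw [lintegral_mul_const _ (measurable_one.indicator hD), lintegral_indicator_one hD]
  · exact ((measurable_PhiIntegrand hf).comp
      (by fun_prop : Measurable fun q : ℝ × ℝ => ((q.1, ζ), q.2))).aemeasurable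

/-- the inner integral on the Palm side (jointly measurable version) -/
noncomputable def gg (f : Measure ℝ → ℝ≥0∞) (η : Measure ℝ) : ℝ≥0∞ :=
  ∫⁻ u, E.indicator 1 (u, η) * f (S (u, η))

lemma measurable_indE : Measurable (E.indicator (1 : ℝ × Measure ℝ → ℝ≥0∞)) :=
  measurable_one.indicator measurableSet_E

lemma measurable_gg {f : Measure ℝ → ℝ≥0∞} (hf : Measurable f) : Measurable (gg f) :=
  Measurable.lintegral_prod_left' (f := fun p : ℝ × Measure ℝ => E.indicator 1 p * f (S p))
    (measurable_indE.mul (hf.comp measurable_S))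

lemma gg_eq (f : Measure ℝ → ℝ≥0∞) {η : Measure ℝ} (h : η ∈ LF) :
    ∫⁻ u in {u : ℝ | 0 ≤ u ∧ ENNReal.ofReal u < tau 1 η}, f (shift u η) ∂volume = gg f η := by
  have hm : MeasurableSet {u : ℝ | (u, η) ∈ E} := measurable_prodMk_right measurableSet_E
  have he : {u : ℝ | 0 ≤ u ∧ ENNReal.ofReal u < tau 1 η} = {u : ℝ | (u, η) ∈ E} := by
    ext u; exact (mem_E_iff u η).symm
  rw [he, ← lintegral_indicator hm]
  unfold gg
  refine lintegral_congr fun u => ?_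
  by_cases hu : (u, η) ∈ E
  · rw [indicator_of_mem (show u ∈ {u : ℝ | (u, η) ∈ E} from hu), indicator_of_mem hu, S_eq h]; simp
  · rw [indicator_of_notMem (show u ∉ {u : ℝ | (u, η) ∈ E} from hu), indicator_of_notMem hu]; simp

lemma palm_inner {f : Measure ℝ → ℝ≥0∞} (hf : Measurable f) {ζ : Measure ℝ} (h : ζ ∈ LF) :
    ∫⁻ v in Ioc (0:ℝ) 1, gg f (shift v ζ) ∂ζ = ∫⁻ w, Phi f (w, S (w, ζ)) := by
  have hI : Measurable ((Ioc (0:ℝ) 1).indicator (1 : ℝ → ℝ≥0∞)) :=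
    measurable_one.indicator measurableSet_Ioc
  set H : ℝ → ℝ → ℝ≥0∞ := fun v w => (Ioc (0:ℝ) 1).indicator (1 : ℝ → ℝ≥0∞) v *
    (E.indicator (1 : ℝ × Measure ℝ → ℝ≥0∞) (w - v, S (v, ζ)) * f (S (w, ζ))) with hH
  have hHm : Measurable (Function.uncurry H) := by
    refine (hI.comp measurable_fst).mul ((measurable_indE.comp ?_).mul (hf.comp ?_))
    · exact (measurable_snd.sub measurable_fst).prodMk
        (measurable_S.comp (measurable_fst.prodMk measurable_const))
    · exact measurable_S.comp (measurable_snd.prodMk measurable_const)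
  have e1 : ∫⁻ v in Ioc (0:ℝ) 1, gg f (shift v ζ) ∂ζ = ∫⁻ v, ∫⁻ w, H v w ∂volume ∂(kap ζ) := by
    rw [kap_eq h, ← lintegral_indicator measurableSet_Ioc]
    refine lintegral_congr fun v => ?_
    have : gg f (shift v ζ) = ∫⁻ w, E.indicator (1 : ℝ × Measure ℝ → ℝ≥0∞) (w - v, S (v, ζ)) * f (S (w, ζ)) := by
      unfold gg
      rw [← lintegral_sub_right_eq_self _ v]
      refine lintegral_congr fun w => ?_
      rw [S_eq (shift_LF v h), S_eq h, S_eq h, shift_shift, sub_add_cancel]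
    by_cases hv : v ∈ Ioc (0:ℝ) 1
    · simp only [hH, indicator_of_mem hv, this, Pi.one_apply, one_mul]
    · simp only [hH, indicator_of_notMem hv, zero_mul, lintegral_zero]
  rw [e1, lintegral_lintegral_swap hHm.aemeasurable]
  refine lintegral_congr fun w => ?_
  unfold Phi
  dsimp only
  rw [S_eq h, kap_eq (shift_LF w h), kap_eq h]
  conv_rhs => rw [shift]
  have hm := (measurable_PhiIntegrand hf).comp
      (by fun_prop : Measurable fun v : ℝ => ((w, shift w ζ), v))
  have := lintegral_map (μ := ζ) hm (show Measurable fun t : ℝ => t - w by fun_prop)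
  refine Eq.trans ?_ this.symm
  refine lintegral_congr fun v => ?_
  simp only [hH, Function.comp, sub_add_cancel, S_eq h]
  congr 2
  by_cases hv : (w - v, shift v ζ) ∈ E
  · rw [indicator_of_mem hv, indicator_of_mem ((mem_D_shift h v w).2 hv)]; rfl
  · rw [indicator_of_notMem hv, indicator_of_notMem (mt (mem_D_shift h v w).1 hv)]

end PalmAux

open PalmAux

/-- Palm inversion formula: for a stationary simple point process `𝔓` with intensity
`I ∈ (0,∞)` and Palm distribution `Q`, and every measurable `f : M(ℝ) → [0,∞]`,
`∫ f(ζ) 1{ζ ≠ 0} d𝔓(ζ) = I ∫ (∫_0^{τ₁(η)} f(θ^u η) du) dQ(η)`. -/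
theorem palm_inversion
    (P Q : Measure (Measure ℝ)) [IsProbabilityMeasure P] [IsProbabilityMeasure Q]
    (hstat : IsStationaryPP P) (hsimple : IsSimplePP P)
    (hI0 : intensity P ≠ 0) (hItop : intensity P ≠ ⊤)
    (hQ : IsPalm P Q)
    (f : Measure ℝ → ℝ≥0∞) (hf : Measurable f) :
    ∫⁻ ζ in {ζ : Measure ℝ | ζ ≠ 0}, f ζ ∂P
      = intensity P *
        ∫⁻ η, (∫⁻ u in {u : ℝ | 0 ≤ u ∧ ENNReal.ofReal u < tau 1 η}, f (shift u η) ∂volume) ∂Q := by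
  have hPLF : ∀ᵐ ζ ∂P, ζ ∈ LF := hsimple.mono fun ζ hζ => simple_LF hζ.1
  have hQLF : ∀ᵐ η ∂Q, η ∈ LF := by
    have h := hQ (LFᶜ.indicator 1) (measurable_one.indicator measurableSet_LF.compl)
    rw [lintegral_indicator_one measurableSet_LF.compl] at h
    have h0 : ∫⁻ ζ, (∫⁻ u in Set.Ioc (0 : ℝ) 1,
        LFᶜ.indicator (1 : Measure ℝ → ℝ≥0∞) (shift u ζ) ∂ζ) ∂P = 0 := by
      rw [lintegral_congr_ae (g := fun _ => 0)]
      · simp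
      · filter_upwards [hPLF] with ζ hζ
        have : ∀ u, LFᶜ.indicator (1 : Measure ℝ → ℝ≥0∞) (shift u ζ) = 0 := fun u =>
          indicator_of_notMem (by simpa using shift_LF u hζ) _
        simp [this]
    rw [h0, mul_zero] at h
    exact h
  have e1 : ∫⁻ η, (∫⁻ u in {u : ℝ | 0 ≤ u ∧ ENNReal.ofReal u < tau 1 η}, f (shift u η) ∂volume) ∂Q
      = ∫⁻ η, gg f η ∂Q := lintegral_congr_ae (hQLF.mono fun η hη => gg_eq f hη)
  rw [e1, hQ _ (measurable_gg hf), ← mul_assoc, ENNReal.mul_inv_cancel hI0 hItop, one_mul]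
  have e2 : ∫⁻ ζ, (∫⁻ u in Set.Ioc (0 : ℝ) 1, gg f (shift u ζ) ∂ζ) ∂P
      = ∫⁻ ζ, ∫⁻ w, Phi f (w, S (w, ζ)) ∂volume ∂P :=
    lintegral_congr_ae (hPLF.mono fun ζ hζ => palm_inner hf hζ)
  have hm1 : Measurable fun p : Measure ℝ × ℝ => Phi f (p.2, S (p.2, p.1)) :=
    (measurable_Phi hf).comp (measurable_snd.prodMk (measurable_S.comp measurable_swap))
  have hm2 : Measurable fun p : Measure ℝ × ℝ => Phi f (p.2, p.1) :=
    (measurable_Phi hf).comp measurable_swap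
  rw [e2, lintegral_lintegral_swap hm1.aemeasurable]
  have e3 : ∀ w : ℝ, ∫⁻ ζ, Phi f (w, S (w, ζ)) ∂P = ∫⁻ ζ, Phi f (w, ζ) ∂P := by
    intro w
    conv_rhs => rw [← hstat w]
    rw [lintegral_map (f := fun ζ => Phi f (w, ζ)) ((measurable_Phi hf).comp measurable_prodMk_left) (measurable_shift w)]
    exact lintegral_congr_ae (hPLF.mono fun ζ hζ => by
      change Phi f (w, S (w, ζ)) = Phi f (w, shift w ζ)
      rw [S_eq hζ])
  simp_rw [e3]
  rw [← lintegral_lintegral_swap hm2.aemeasurable]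
  have hne : MeasurableSet {ζ : Measure ℝ | ζ ≠ 0} := by
    have : {ζ : Measure ℝ | ζ ≠ 0} = {ζ : Measure ℝ | ζ univ = 0}ᶜ := by
      ext ζ; simp
    rw [this]
    exact (Measure.measurable_coe MeasurableSet.univ (measurableSet_singleton 0)).compl
  rw [← lintegral_indicator hne]
  refine lintegral_congr_ae ?_
  filter_upwards [hsimple, hPLF, ae_recur P hstat] with ζ hs hL hr
  rw [lintegral_Phi hf, kap_eq hL]
  by_cases hz : ζ = 0
  · subst hz; simp
  · rw [indicator_of_mem (show ζ ∈ {ζ : Measure ℝ | ζ ≠ 0} from hz)]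
    simp_rw [mem_D_iff hL]
    rw [measure_last hs.1 hs.2 (hr hz), one_mul]
end

section
/- Kac-type formula for Palm distributions: let 𝔓 be a stationary simple point process on ℝ with intensity I ∈ (0,∞) and Palm distribution Q. Then 𝔓({ζ ∈ M(ℝ) : ζ ≠ 0}) = I · ∫ τ₁(η) dQ(η); in particular the mean of τ₁ under Q is finite and equals 𝔓(ζ ≠ 0)/I. -/
open MeasureTheory Set Filter
open scoped ENNReal

/-- Pathwise regularity of a realisation of a simple point process. -/
def NiceConf (ζ : Measure ℝ) : Prop :=
  (∀ B : Set ℝ, Bornology.IsBounded B → MeasurableSet B → ∃ n : ℕ, ζ B = (n : ℝ≥0∞)) ∧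
    ∀ t : ℝ, ζ ({t} : Set ℝ) ≤ 1

lemma NiceConf.lt_one {ζ : Measure ℝ} (h : NiceConf ζ) (a b : ℝ) :
    ζ (Ioc a b) < 1 ↔ ζ (Ioc a b) = 0 := by
  obtain ⟨n, hn⟩ := h.1 (Ioc a b) (Metric.isBounded_Ioc a b) measurableSet_Ioc
  rw [hn]
  norm_cast
  omega

lemma NiceConf.lt_top {ζ : Measure ℝ} (h : NiceConf ζ) (a b : ℝ) :
    ζ (Ioc a b) < ⊤ := by
  obtain ⟨n, hn⟩ := h.1 (Ioc a b) (Metric.isBounded_Ioc a b) measurableSet_Ioc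
  rw [hn]
  exact ENNReal.natCast_lt_top n

lemma tau_one_eq (ζ : Measure ℝ) :
    tau 1 ζ = sInf ((fun s : ℝ => ENNReal.ofReal s) '' {s : ℝ | 0 < s ∧ 1 ≤ ζ (Set.Ioc 0 s)}) := by
  simp [tau]

lemma tau_eq_vol (η : Measure ℝ) : tau 1 η = volume {s : ℝ | 0 < s ∧ η (Ioc 0 s) < 1} := by
  rw [tau_one_eq]
  apply le_antisymm
  · apply ENNReal.le_of_forall_nnreal_lt
    intro r hr
    have hsub : Ioc (0 : ℝ) r ⊆ {s : ℝ | 0 < s ∧ η (Ioc 0 s) < 1} := by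
      intro s hs
      refine ⟨hs.1, ?_⟩
      by_contra hcon
      push Not at hcon
      have h1 : sInf ((fun s : ℝ => ENNReal.ofReal s) ''
          {s : ℝ | 0 < s ∧ 1 ≤ η (Set.Ioc 0 s)}) ≤ ENNReal.ofReal s :=
        sInf_le ⟨s, ⟨hs.1, hcon⟩, rfl⟩
      have h2 : ENNReal.ofReal s ≤ r := by
        rw [← ENNReal.ofReal_coe_nnreal]
        exact ENNReal.ofReal_le_ofReal hs.2
      exact absurd hr (not_lt.2 (h1.trans h2))
    calc (r : ℝ≥0∞) = volume (Ioc (0 : ℝ) r) := by simp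
      _ ≤ _ := measure_mono hsub
  · apply le_sInf
    rintro _ ⟨s, ⟨hs0, hs⟩, rfl⟩
    have hsub : {s : ℝ | 0 < s ∧ η (Ioc 0 s) < 1} ⊆ Ioc 0 s := by
      rintro t ⟨ht0, ht⟩
      refine ⟨ht0, ?_⟩
      by_contra hcon
      push Not at hcon
      exact absurd ht (not_lt.2 (hs.trans (measure_mono (Ioc_subset_Ioc_right hcon.le))))
    calc _ ≤ volume (Ioc 0 s) := measure_mono hsub
      _ = _ := by simp

lemma shift_Ioc (u a b : ℝ) (ζ : Measure ℝ) :
    shift u ζ (Ioc a b) = ζ (Ioc (a + u) (b + u)) := by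
  rw [shift, Measure.map_apply (by fun_prop) measurableSet_Ioc]
  congr 1
  ext t
  simp only [mem_preimage, mem_Ioc]
  constructor <;> rintro ⟨h1, h2⟩ <;> constructor <;> linarith

lemma tau_shift_eq (u : ℝ) (ζ : Measure ℝ) :
    tau 1 (shift u ζ) = volume {y : ℝ | u < y ∧ ζ (Ioc u y) < 1} := by
  rw [tau_eq_vol]
  have : {s : ℝ | 0 < s ∧ shift u ζ (Ioc 0 s) < 1}
      = (fun s => s + u) ⁻¹' {y : ℝ | u < y ∧ ζ (Ioc u y) < 1} := by
    ext s
    simp [shift_Ioc]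
  rw [this, measure_preimage_add_right]

lemma measurable_tau : Measurable (tau 1) := by
  have : tau 1 = fun ζ : Measure ℝ => ⨅ q : ℚ, 
      if (0 : ℝ) < q ∧ 1 ≤ ζ (Ioc (0 : ℝ) q) then ENNReal.ofReal q else ⊤ := by
    funext ζ
    rw [tau_one_eq]
    apply le_antisymm
    · apply le_iInf
      intro q
      split_ifs with h
      · exact sInf_le ⟨q, h, rfl⟩
      · exact le_top
    · apply le_sInf
      rintro _ ⟨s, ⟨hs0, hs⟩, rfl⟩
      apply ENNReal.le_of_forall_pos_le_add
      intro ε hε _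
      obtain ⟨q, hq1, hq2⟩ := exists_rat_btwn (show s < s + ε by
        have : (0 : ℝ) < ε := hε
        linarith)
      refine (iInf_le _ q).trans ?_
      rw [if_pos ⟨hs0.trans hq1, hs.trans (measure_mono (Ioc_subset_Ioc_right hq1.le))⟩]
      beta_reduce
      rw [← ENNReal.ofReal_coe_nnreal, ← ENNReal.ofReal_add hs0.le (NNReal.coe_nonneg ε)]
      exact ENNReal.ofReal_le_ofReal hq2.le
  rw [this]
  refine Measurable.iInf fun q => Measurable.ite ?_ measurable_const measurable_const
  by_cases h : (0 : ℝ) < q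
  · simp only [h, true_and]
    exact measurableSet_le measurable_const (Measure.measurable_coe measurableSet_Ioc)
  · simp [h]

lemma measurable_shift (u : ℝ) : Measurable (shift u) :=
  Measure.measurable_map _ (by fun_prop)

/-- The set of `u ∈ (0,m]` with no point in `(u,m]` carries mass one. -/
lemma last_point {ζ : Measure ℝ} (h : NiceConf ζ) {m : ℝ} (hm : 0 < m)
    (hne : ζ (Ioc 0 m) ≠ 0) : ζ {u | u ∈ Ioc 0 m ∧ ζ (Ioc u m) = 0} = 1 := by
  set A : Set ℝ := {u | 0 ≤ u ∧ ζ (Ioc u m) = 0} with hA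
  have hmA : m ∈ A := ⟨hm.le, by simp⟩
  have hbdd : BddBelow A := ⟨0, fun u hu => hu.1⟩
  set a := sInf A with ha
  have ha0 : 0 ≤ a := le_csInf ⟨m, hmA⟩ fun u hu => hu.1
  have ham : a ≤ m := csInf_le hbdd hmA
  have hz : ∀ v, a < v → ζ (Ioc v m) = 0 := by
    intro v hv
    obtain ⟨u, hu, huv⟩ := exists_lt_of_csInf_lt ⟨m, hmA⟩ hv
    exact measure_mono_null (Ioc_subset_Ioc_left huv.le) hu.2
  obtain ⟨w, -, hw2, hw3⟩ := exists_seq_strictAnti_tendsto a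
  have haz : ζ (Ioc a m) = 0 := by
    have : Ioc a m ⊆ ⋃ n, Ioc (w n) m := by
      intro t ht
      obtain ⟨n, hn⟩ := (hw3.eventually (gt_mem_nhds ht.1)).exists
      exact mem_iUnion.2 ⟨n, hn, ht.2⟩
    exact measure_mono_null this (measure_iUnion_null fun n => hz _ (hw2 n))
  have hapos : 0 < a := by
    rcases ha0.lt_or_eq with h' | h'
    · exact h'
    · rw [← h'] at haz
      exact absurd haz hne
  have hS : {u | u ∈ Ioc 0 m ∧ ζ (Ioc u m) = 0} = Icc a m := by
    ext u
    constructor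
    · rintro ⟨h1, h2⟩
      exact ⟨csInf_le hbdd ⟨h1.1.le, h2⟩, h1.2⟩
    · rintro ⟨h1, h2⟩
      exact ⟨⟨hapos.trans_le h1, h2⟩, measure_mono_null (Ioc_subset_Ioc_left h1) haz⟩
  rw [hS]
  apply le_antisymm
  · calc ζ (Icc a m) ≤ ζ ({a} ∪ Ioc a m) := measure_mono (by
          intro t ht
          rcases ht.1.eq_or_lt with h' | h'
          · left; exact h'.symm
          · right; exact ⟨h', ht.2⟩)
      _ ≤ ζ {a} + ζ (Ioc a m) := measure_union_le _ _
      _ ≤ 1 := by rw [haz, add_zero]; exact h.2 a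
  · obtain ⟨v, hv1, hv2, hv3⟩ := exists_seq_strictMono_tendsto' hapos
    have hI : Icc a m = ⋂ n, Ioc (v n) m := by
      ext t
      simp only [mem_iInter, mem_Icc, mem_Ioc]
      constructor
      · rintro ⟨h1, h2⟩ n
        exact ⟨(hv2 n).2.trans_le h1, h2⟩
      · intro ht
        exact ⟨le_of_tendsto' hv3 fun n => (ht n).1.le, (ht 0).2⟩
    have hlim : Tendsto (fun n => ζ (Ioc (v n) m)) atTop (nhds (ζ (Icc a m))) := by
      rw [hI]
      apply tendsto_measure_iInter_atTop
      · exact fun n => measurableSet_Ioc.nullMeasurableSet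
      · intro i j hij
        exact Ioc_subset_Ioc_left (hv1.monotone hij)
      · exact ⟨0, (h.lt_top _ _).ne⟩
    apply ge_of_tendsto' hlim
    intro n
    by_contra hcon
    push Not at hcon
    have := (h.lt_one _ _).1 hcon
    exact absurd (csInf_le hbdd (show v n ∈ A from ⟨(hv2 n).1.le, this⟩))
      (not_le.2 (hv2 n).2)

lemma Ioc_zero_iff {ζ : Measure ℝ} (h : NiceConf ζ) {u y : ℝ} (hu : 0 < u) (huy : u ≤ y) :
    ζ (Ioc u y) = 0 ↔ ζ (Ioc 0 y) ≤ ζ (Ioc 0 u) := by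
  have : ζ (Ioc 0 y) = ζ (Ioc 0 u) + ζ (Ioc u y) := by
    rw [← Ioc_union_Ioc_eq_Ioc hu.le huy]
    apply measure_union _ measurableSet_Ioc
    rw [Set.disjoint_left]
    intro t h1 h2
    exact absurd h1.2 (not_le.2 h2.1)
  rw [this]
  constructor
  · intro h0; simp [h0]
  · intro h0
    have h1 : ζ (Ioc 0 u) + ζ (Ioc u y) ≤ ζ (Ioc 0 u) + 0 := by simpa using h0
    have := (ENNReal.add_le_add_iff_left (h.lt_top 0 u).ne).1 h1
    simpa using this

lemma slice {ζ : Measure ℝ} (h : NiceConf ζ) (y : ℝ) :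
    ζ {u | u ∈ Ioc 0 1 ∧ u ≤ y ∧ ζ (Ioc u y) = 0} =
      indicator {y : ℝ | 0 < y ∧ ζ (Ioc 0 (min 1 y)) ≠ 0 ∧ ζ (Ioc (min 1 y) y) = 0}
        (fun _ => (1 : ℝ≥0∞)) y := by
  set m := min 1 y with hm
  have h1 : m ≤ 1 := min_le_left _ _
  have h2 : m ≤ y := min_le_right _ _
  by_cases hy : y ∈ {y : ℝ | 0 < y ∧ ζ (Ioc 0 (min 1 y)) ≠ 0 ∧ ζ (Ioc (min 1 y) y) = 0}
  · rw [indicator_of_mem hy]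
    obtain ⟨hy0, hy1, hy2⟩ := hy
    have hm0 : 0 < m := lt_min one_pos hy0
    rw [← last_point h hm0 hy1]
    congr 1
    ext u
    simp only [mem_ofPred_eq, mem_Ioc]
    constructor
    · rintro ⟨⟨a, b⟩, c, d⟩
      exact ⟨⟨a, le_min b c⟩, measure_mono_null (Ioc_subset_Ioc_right h2) d⟩
    · rintro ⟨⟨a, b⟩, d⟩
      refine ⟨⟨a, b.trans h1⟩, b.trans h2, ?_⟩
      rw [← Ioc_union_Ioc_eq_Ioc b h2]
      exact measure_union_null d hy2
  · rw [indicator_of_notMem hy]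
    by_cases hy0 : 0 < y
    · by_cases hy1 : ζ (Ioc 0 m) = 0
      · refine measure_mono_null ?_ hy1
        rintro u ⟨⟨a, b⟩, c, d⟩
        exact ⟨a, le_min b c⟩
      · have hy2 : ζ (Ioc m y) ≠ 0 := fun h' => hy ⟨hy0, hy1, h'⟩
        convert measure_empty (μ := ζ)
        rw [eq_empty_iff_forall_notMem]
        rintro u ⟨⟨a, b⟩, c, d⟩
        exact hy2 (measure_mono_null (Ioc_subset_Ioc_left (le_min b c)) d)
    · convert measure_empty (μ := ζ)
      rw [eq_empty_iff_forall_notMem]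
      rintro u ⟨⟨a, b⟩, c, d⟩
      exact hy0 (a.trans_le c)

lemma path_tonelli {ζ : Measure ℝ} (h : NiceConf ζ) :
    ∫⁻ u in Ioc (0 : ℝ) 1, tau 1 (shift u ζ) ∂ζ =
      volume {y : ℝ | 0 < y ∧ ζ (Ioc 0 (min 1 y)) ≠ 0 ∧ ζ (Ioc (min 1 y) y) = 0} := by
  set S : Set (ℝ × ℝ) := {p | 0 < p.1 ∧ p.1 ≤ p.2 ∧ ζ (Ioc 0 p.2) ≤ ζ (Ioc 0 p.1)} with hS
  have hmono : Monotone fun y : ℝ => ζ (Ioc 0 y) :=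
    fun a b hab => measure_mono (Ioc_subset_Ioc_right hab)
  have hSm : MeasurableSet S := by
    refine (measurableSet_lt measurable_const measurable_fst).inter
      ((measurableSet_le measurable_fst measurable_snd).inter
      (measurableSet_le (hmono.measurable.comp measurable_snd)
        (hmono.measurable.comp measurable_fst)))
  have : IsFiniteMeasure (ζ.restrict (Ioc (0 : ℝ) 1)) :=
    ⟨by rw [Measure.restrict_apply_univ]; exact h.lt_top 0 1⟩
  have hmin : Measurable fun y : ℝ => min 1 y := by fun_prop
  have e1 : ∫⁻ u in Ioc (0 : ℝ) 1, tau 1 (shift u ζ) ∂ζ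
      = ((ζ.restrict (Ioc (0 : ℝ) 1)).prod volume) S := by
    rw [Measure.prod_apply hSm]
    apply setLIntegral_congr_fun measurableSet_Ioc
    intro u hu
    simp only
    rw [tau_shift_eq]
    have : Prod.mk u ⁻¹' S = {y : ℝ | u ≤ y ∧ ζ (Ioc u y) < 1} := by
      ext y
      simp only [hS, mem_preimage, mem_ofPred_eq, h.lt_one]
      constructor
      · rintro ⟨a, b, c⟩
        exact ⟨b, (Ioc_zero_iff h a b).2 c⟩
      · rintro ⟨b, c⟩
        exact ⟨hu.1, b, (Ioc_zero_iff h hu.1 b).1 c⟩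
    rw [this]
    apply le_antisymm
    · exact measure_mono fun y hy => ⟨hy.1.le, hy.2⟩
    · calc _ ≤ volume ({u} ∪ {y : ℝ | u < y ∧ ζ (Ioc u y) < 1}) := measure_mono (by
            rintro y ⟨a, b⟩
            rcases a.eq_or_lt with h' | h'
            · left; exact h'.symm
            · right; exact ⟨h', b⟩)
        _ ≤ volume {u} + volume {y : ℝ | u < y ∧ ζ (Ioc u y) < 1} := measure_union_le _ _
        _ = _ := by simp
  have key : ∀ y : ℝ, (ζ.restrict (Ioc (0 : ℝ) 1)) ((fun u => (u, y)) ⁻¹' S) =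
      indicator {y : ℝ | 0 < y ∧ ζ (Ioc 0 (min 1 y)) ≠ 0 ∧ ζ (Ioc (min 1 y) y) = 0}
        (fun _ => (1 : ℝ≥0∞)) y := by
    intro y
    rw [← slice h y, Measure.restrict_apply (measurable_prodMk_right hSm)]
    congr 1
    ext u
    simp only [hS, mem_inter_iff, mem_preimage, mem_ofPred_eq]
    constructor
    · rintro ⟨⟨a, b, c⟩, d⟩
      exact ⟨d, b, (Ioc_zero_iff h a b).2 c⟩
    · rintro ⟨a, b, c⟩
      exact ⟨⟨a.1, b, (Ioc_zero_iff h a.1 b).1 c⟩, a⟩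
  have hTm : MeasurableSet {y : ℝ | 0 < y ∧ ζ (Ioc 0 (min 1 y)) ≠ 0 ∧
      ζ (Ioc (min 1 y) y) = 0} := by
    have : {y : ℝ | 0 < y ∧ ζ (Ioc 0 (min 1 y)) ≠ 0 ∧ ζ (Ioc (min 1 y) y) = 0}
        = {y : ℝ | 0 < y ∧ ζ (Ioc 0 (min 1 y)) ≠ 0 ∧ ζ (Ioc 0 y) ≤ ζ (Ioc 0 (min 1 y))} := by
      ext y
      simp only [mem_ofPred_eq]
      refine and_congr_right fun hy => and_congr_right fun _ => ?_
      exact Ioc_zero_iff h (lt_min one_pos hy) (min_le_right _ _)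
    rw [this]
    refine (measurableSet_lt measurable_const measurable_id).inter
      (MeasurableSet.inter ?_ (measurableSet_le hmono.measurable (hmono.measurable.comp hmin)))
    exact (measurableSet_eq_fun (hmono.measurable.comp hmin) measurable_const).compl
  rw [e1, Measure.prod_apply_symm hSm]
  simp_rw [key]
  rw [lintegral_indicator hTm]
  simp

lemma path_case {ζ : Measure ℝ} (h : NiceConf ζ) (h1 : ζ (Ioc 0 1) ≠ 0) :
    ∫⁻ u in Ioc (0 : ℝ) 1, tau 1 (shift u ζ) ∂ζ + tau 1 ζ = 1 + tau 1 (shift 1 ζ) := by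
  rw [path_tonelli h, tau_eq_vol ζ, tau_shift_eq]
  simp_rw [h.lt_one]
  have hmono : Monotone fun y : ℝ => ζ (Ioc 0 y) :=
    fun a b hab => measure_mono (Ioc_subset_Ioc_right hab)
  have hm1 : MeasurableSet {s : ℝ | 0 < s ∧ ζ (Ioc 0 s) = 0} :=
    (measurableSet_lt measurable_const measurable_id).inter
      (measurableSet_eq_fun hmono.measurable measurable_const)
  have hmono1 : Monotone fun y : ℝ => ζ (Ioc 1 y) :=
    fun a b hab => measure_mono (Ioc_subset_Ioc_right hab)
  have hm2 : MeasurableSet {y : ℝ | 1 < y ∧ ζ (Ioc 1 y) = 0} :=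
    (measurableSet_lt measurable_const measurable_id).inter
      (measurableSet_eq_fun hmono1.measurable measurable_const)
  have e : (1 : ℝ≥0∞) = volume (Ioc (0 : ℝ) 1) := by simp
  rw [e, ← measure_union _ hm1, ← measure_union _ hm2]
  · congr 1
    ext y
    simp only [mem_union, mem_ofPred_eq, mem_Ioc]
    rcases le_or_gt y 1 with hy | hy
    · rw [min_eq_right hy]
      simp only [Ioc_self, measure_empty, and_true, hy, not_lt.2 hy, false_and, or_false]
      tauto
    · rw [min_eq_left hy.le]
      have : ζ (Ioc 0 y) ≠ 0 := fun h' => h1 (measure_mono_null (Ioc_subset_Ioc_right hy.le) h')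
      simp [h1, hy, this, not_le.2 hy, zero_lt_one.trans hy]
  · rw [Set.disjoint_left]
    rintro y ⟨-, a⟩ ⟨b, -⟩
    exact absurd a (not_le.2 b)
  · rw [Set.disjoint_left]
    rintro y ⟨-, a, -⟩ ⟨-, b⟩
    exact a (measure_mono_null (Ioc_subset_Ioc_right (min_le_right _ _)) b)

lemma path_case0 {ζ : Measure ℝ} (h : NiceConf ζ) (h1 : ζ (Ioc 0 1) = 0) :
    tau 1 ζ = 1 + tau 1 (shift 1 ζ) := by
  rw [tau_eq_vol ζ, tau_shift_eq]
  simp_rw [h.lt_one]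
  have hmono1 : Monotone fun y : ℝ => ζ (Ioc 1 y) :=
    fun a b hab => measure_mono (Ioc_subset_Ioc_right hab)
  have hm2 : MeasurableSet {y : ℝ | 1 < y ∧ ζ (Ioc 1 y) = 0} :=
    (measurableSet_lt measurable_const measurable_id).inter
      (measurableSet_eq_fun hmono1.measurable measurable_const)
  have e : (1 : ℝ≥0∞) = volume (Ioc (0 : ℝ) 1) := by simp
  rw [e, ← measure_union _ hm2]
  · congr 1
    ext y
    simp only [mem_union, mem_ofPred_eq, mem_Ioc]
    rcases le_or_gt y 1 with hy | hy
    · simp only [hy, not_lt.2 hy, false_and, or_false, and_true, and_iff_left_iff_imp]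
      intro _
      exact measure_mono_null (Ioc_subset_Ioc_right hy) h1
    · simp only [zero_lt_one.trans hy, not_le.2 hy, hy, true_and, and_false, false_or]
      rw [← Ioc_union_Ioc_eq_Ioc zero_le_one hy.le]
      simp [h1]
  · rw [Set.disjoint_left]
    rintro y ⟨-, a⟩ ⟨b, -⟩
    exact absurd a (not_le.2 b)

lemma tau_le_one {ζ : Measure ℝ} (h : NiceConf ζ) (h1 : ζ (Ioc 0 1) ≠ 0) : tau 1 ζ ≤ 1 := by
  rw [tau_one_eq]
  refine sInf_le ⟨1, ⟨one_pos, ?_⟩, by simp⟩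
  by_contra hcon
  exact h1 ((h.lt_one _ _).1 (not_le.1 hcon))

/-- Truncated version of the inner Palm integral. -/
noncomputable def truncF (N : ℕ) (ζ : Measure ℝ) : ℝ≥0∞ :=
  if ζ (Ioc (0 : ℝ) 1) = 0 then 0 else (1 - tau 1 ζ) + min (tau 1 (shift 1 ζ)) N

lemma measurable_truncF (N : ℕ) : Measurable (truncF N) := by
  refine Measurable.ite ?_ measurable_const ?_
  · exact measurableSet_eq_fun (Measure.measurable_coe measurableSet_Ioc) measurable_const
  · exact (measurable_const.sub measurable_tau).add
      ((measurable_tau.comp (measurable_shift 1)).min measurable_const)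

lemma truncF_mono (ζ : Measure ℝ) : Monotone fun N => truncF N ζ := by
  intro a b hab
  simp only [truncF]
  split_ifs
  · exact le_rfl
  · gcongr

lemma truncF_sup {ζ : Measure ℝ} (h : NiceConf ζ) :
    ∫⁻ u in Ioc (0 : ℝ) 1, tau 1 (shift u ζ) ∂ζ = ⨆ N, truncF N ζ := by
  by_cases h1 : ζ (Ioc (0 : ℝ) 1) = 0
  · simp [truncF, h1, Measure.restrict_eq_zero.2 h1]
  · have hle := tau_le_one h h1
    have e := path_case h h1
    simp only [truncF, h1, if_false]
    rw [← ENNReal.add_iSup, ← inf_iSup_eq]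
    rw [ENNReal.iSup_natCast, inf_top_eq]
    have ht : tau 1 ζ ≠ ⊤ := ne_top_of_le_ne_top ENNReal.one_ne_top hle
    rw [← ENNReal.add_left_inj ht, e, add_right_comm, tsub_add_cancel_of_le hle]

lemma truncF_add {ζ : Measure ℝ} (h : NiceConf ζ) (N : ℕ) :
    truncF N ζ + min (tau 1 ζ) (N + 1) = 1 + min (tau 1 (shift 1 ζ)) N := by
  by_cases h1 : ζ (Ioc (0 : ℝ) 1) = 0
  · simp only [truncF, h1, if_true]
    rw [path_case0 h h1, zero_add, add_comm (N : ℝ≥0∞) 1, min_add_add_left]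
  · have hle := tau_le_one h h1
    simp only [truncF, h1, if_false]
    rw [min_eq_left (hle.trans le_add_self), add_right_comm, tsub_add_cancel_of_le hle]

lemma tau_top_iff {ζ : Measure ℝ} (h : NiceConf ζ) : tau 1 ζ = ⊤ ↔ ζ (Ioi 0) = 0 := by
  rw [tau_one_eq, sInf_eq_top]
  constructor
  · intro h'
    have : Ioi (0 : ℝ) ⊆ ⋃ n : ℕ, Ioc 0 (n : ℝ) := by
      intro t ht
      obtain ⟨n, hn⟩ := exists_nat_ge t
      exact mem_iUnion.2 ⟨n, ht, hn⟩
    refine measure_mono_null this (measure_iUnion_null fun n => ?_)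
    rw [← h.lt_one]
    by_contra hcon
    push Not at hcon
    by_cases hn : (0 : ℝ) < n
    · exact absurd (h' _ ⟨(n : ℝ), ⟨hn, hcon⟩, rfl⟩) ENNReal.ofReal_ne_top
    · rw [Ioc_eq_empty hn] at hcon
      simp at hcon
  · rintro h' _ ⟨s, ⟨hs0, hs⟩, rfl⟩
    rw [measure_mono_null Ioc_subset_Ioi_self h'] at hs
    simp at hs

lemma prob_Ioi_zero (P : Measure (Measure ℝ)) [IsProbabilityMeasure P]
    (hstat : IsStationaryPP P) : P {ζ | ζ (Ioi (0 : ℝ)) = 0} = P {ζ | ζ = 0} := by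
  have hm : ∀ a : ℝ, MeasurableSet {ζ : Measure ℝ | ζ (Ioi a) = 0} := fun a =>
    measurableSet_eq_fun (Measure.measurable_coe measurableSet_Ioi) measurable_const
  have hc : ∀ n : ℕ, P {ζ | ζ (Ioi (-(n : ℝ))) = 0} = P {ζ | ζ (Ioi (0 : ℝ)) = 0} := by
    intro n
    conv_rhs => rw [← hstat (-(n : ℝ)), Measure.map_apply (measurable_shift _) (hm 0)]
    congr 1
    ext ζ
    simp only [mem_ofPred_eq, mem_preimage]
    rw [shift, Measure.map_apply (by fun_prop) measurableSet_Ioi]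
    have : (fun t : ℝ => t - -(n : ℝ)) ⁻¹' Ioi 0 = Ioi (-(n : ℝ)) := by
      ext t
      simp only [mem_preimage, mem_Ioi]
      constructor <;> intro <;> linarith
    rw [this]
  have hI : {ζ : Measure ℝ | ζ = 0} = ⋂ n : ℕ, {ζ | ζ (Ioi (-(n : ℝ))) = 0} := by
    ext ζ
    simp only [mem_ofPred_eq, mem_iInter]
    constructor
    · rintro rfl n; simp
    · intro h'
      rw [← Measure.measure_univ_eq_zero]
      have : (univ : Set ℝ) ⊆ ⋃ n : ℕ, Ioi (-(n : ℝ)) := by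
        intro t _
        obtain ⟨n, hn⟩ := exists_nat_gt (-t)
        exact mem_iUnion.2 ⟨n, by simp only [mem_Ioi]; linarith⟩
      exact measure_mono_null this (measure_iUnion_null h')
  have hlim : Tendsto (fun n : ℕ => P {ζ | ζ (Ioi (-(n : ℝ))) = 0}) atTop
      (nhds (P {ζ | ζ = 0})) := by
    rw [hI]
    apply tendsto_measure_iInter_atTop
    · exact fun n => (hm _).nullMeasurableSet
    · intro i j hij ζ hζ
      refine measure_mono_null (Ioi_subset_Ioi ?_) hζ
      have : (i : ℝ) ≤ j := by exact_mod_cast hij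
      linarith
    · exact ⟨0, measure_ne_top _ _⟩
  simp_rw [hc] at hlim
  exact tendsto_nhds_unique tendsto_const_nhds hlim

lemma trunc_diff (x : ℝ≥0∞) :
    Tendsto (fun N : ℕ => min x (N + 1) - min x N) atTop (nhds (if x = ⊤ then 1 else 0)) := by
  split_ifs with hx
  · subst hx
    refine tendsto_const_nhds.congr fun N => ?_
    simp only [min_eq_right le_top]
    exact (ENNReal.add_sub_cancel_left (ENNReal.natCast_ne_top N)).symm
  · obtain ⟨n, hn⟩ := ENNReal.exists_nat_gt hx
    refine tendsto_const_nhds.congr' ?_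
    filter_upwards [eventually_ge_atTop n] with N hN
    have : x ≤ N := hn.le.trans (by exact_mod_cast hN)
    rw [min_eq_left this, min_eq_left (this.trans le_self_add), tsub_self]

lemma trunc_diff_le (x : ℝ≥0∞) (N : ℕ) : min x (N + 1) - min x N ≤ 1 := by
  rw [tsub_le_iff_left, ← min_add_add_right]
  exact min_le_min le_self_add le_rfl

lemma main_expect (P : Measure (Measure ℝ)) [IsProbabilityMeasure P]
    (hstat : IsStationaryPP P) (hnice : ∀ᵐ ζ ∂P, NiceConf ζ) :
    ∫⁻ ζ, (∫⁻ u in Ioc (0 : ℝ) 1, tau 1 (shift u ζ) ∂ζ) ∂P = P {ζ | ζ ≠ 0} := by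
  have hmt := measurable_tau
  have hD : ∀ N : ℕ, Measurable fun ζ : Measure ℝ => min (tau 1 ζ) (N + 1) - min (tau 1 ζ) N :=
    fun N => (hmt.min measurable_const).sub (hmt.min measurable_const)
  have e1 : ∀ N : ℕ, ∫⁻ ζ, truncF N ζ ∂P +
      ∫⁻ ζ, (min (tau 1 ζ) (N + 1) - min (tau 1 ζ) N) ∂P = 1 := by
    intro N
    have hfin : ∫⁻ ζ, min (tau 1 ζ) N ∂P ≠ ⊤ := by
      refine ne_top_of_le_ne_top (b := (N : ℝ≥0∞)) (ENNReal.natCast_ne_top N) ?_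
      calc _ ≤ ∫⁻ _, (N : ℝ≥0∞) ∂P := lintegral_mono fun ζ => min_le_right _ _
        _ = N := by simp
    have hsh : ∫⁻ ζ, min (tau 1 (shift 1 ζ)) N ∂P = ∫⁻ ζ, min (tau 1 ζ) N ∂P := by
      conv_rhs => rw [← hstat 1]
      rw [lintegral_map (hmt.min measurable_const) (measurable_shift 1)]
    have hN : ∫⁻ ζ, (truncF N ζ + min (tau 1 ζ) (N + 1)) ∂P
        = ∫⁻ ζ, (1 + min (tau 1 (shift 1 ζ)) N) ∂P :=
      lintegral_congr_ae (by filter_upwards [hnice] with ζ hζ using truncF_add hζ N)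
    rw [lintegral_add_left (measurable_truncF N), lintegral_add_left measurable_const, hsh] at hN
    have hsp : ∫⁻ ζ, min (tau 1 ζ) (N + 1) ∂P
        = ∫⁻ ζ, (min (tau 1 ζ) (N + 1) - min (tau 1 ζ) N) ∂P + ∫⁻ ζ, min (tau 1 ζ) N ∂P := by
      rw [← lintegral_add_left (hD N)]
      refine lintegral_congr fun ζ => ?_
      rw [tsub_add_cancel_of_le (min_le_min le_rfl le_self_add)]
    rw [hsp, ← add_assoc] at hN
    have := (ENNReal.add_left_inj hfin).1 hN
    simpa using this
  have l1 : Tendsto (fun N : ℕ => ∫⁻ ζ, truncF N ζ ∂P) atTop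
      (nhds (∫⁻ ζ, (∫⁻ u in Ioc (0 : ℝ) 1, tau 1 (shift u ζ) ∂ζ) ∂P)) := by
    have : ∫⁻ ζ, (∫⁻ u in Ioc (0 : ℝ) 1, tau 1 (shift u ζ) ∂ζ) ∂P
        = ⨆ N, ∫⁻ ζ, truncF N ζ ∂P := by
      rw [← lintegral_iSup measurable_truncF (fun a b hab ζ => truncF_mono ζ hab)]
      exact lintegral_congr_ae (by filter_upwards [hnice] with ζ hζ using truncF_sup hζ)
    rw [this]
    exact tendsto_atTop_iSup fun a b hab => lintegral_mono fun ζ => truncF_mono ζ hab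
  have l2 : Tendsto (fun N : ℕ => ∫⁻ ζ, (min (tau 1 ζ) (N + 1) - min (tau 1 ζ) N) ∂P) atTop
      (nhds (∫⁻ ζ, (if tau 1 ζ = ⊤ then 1 else 0) ∂P)) := by
    refine tendsto_lintegral_of_dominated_convergence (fun _ => 1) hD
      (fun N => Eventually.of_forall fun ζ => trunc_diff_le _ _) (by simp)
      (Eventually.of_forall fun ζ => trunc_diff _)
  have hz : ∫⁻ ζ, (if tau 1 ζ = ⊤ then 1 else 0) ∂P = P {ζ | ζ = 0} := by
    rw [← prob_Ioi_zero P hstat]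
    have hm : MeasurableSet {ζ : Measure ℝ | ζ (Ioi (0 : ℝ)) = 0} :=
      measurableSet_eq_fun (Measure.measurable_coe measurableSet_Ioi) measurable_const
    rw [← lintegral_indicator_one hm]
    refine lintegral_congr_ae ?_
    filter_upwards [hnice] with ζ hζ
    simp only [tau_top_iff hζ, indicator, mem_ofPred_eq, Pi.one_apply]
  rw [hz] at l2
  have l3 := l1.add l2
  simp_rw [e1] at l3
  have e2 := tendsto_nhds_unique tendsto_const_nhds l3
  have hm0 : MeasurableSet {ζ : Measure ℝ | ζ = 0} := by
    have : {ζ : Measure ℝ | ζ = 0} = {ζ | ζ univ = 0} := by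
      ext ζ
      exact Measure.measure_univ_eq_zero.symm
    rw [this]
    exact measurableSet_eq_fun (Measure.measurable_coe MeasurableSet.univ) measurable_const
  have e3 : P {ζ | ζ ≠ 0} + P {ζ | ζ = 0} = 1 := by
    have := measure_add_measure_compl (μ := P) hm0
    rw [measure_univ] at this
    rw [add_comm]
    exact this
  rw [← e3] at e2
  exact ((ENNReal.add_left_inj (measure_ne_top _ _)).1 e2).symm


/-- Kac-type formula for Palm distributions: `𝔓(ζ ≠ 0) = I · ∫ τ₁ dQ`; in particular the
mean of `τ₁` under `Q` is finite and equals `𝔓(ζ ≠ 0)/I`. -/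
theorem palm_kac_formula
    (P Q : Measure (Measure ℝ)) [IsProbabilityMeasure P] [IsProbabilityMeasure Q]
    (hstat : IsStationaryPP P) (hsimple : IsSimplePP P)
    (hI0 : intensity P ≠ 0) (hItop : intensity P ≠ ⊤)
    (hQ : IsPalm P Q) :
    P {ζ : Measure ℝ | ζ ≠ 0} = intensity P * ∫⁻ η, tau 1 η ∂Q ∧
      ∫⁻ η, tau 1 η ∂Q ≠ ⊤ ∧
      ∫⁻ η, tau 1 η ∂Q = P {ζ : Measure ℝ | ζ ≠ 0} / intensity P := by
  have hmain := main_expect P hstat hsimple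
  have hQt := hQ (tau 1) measurable_tau
  rw [hmain] at hQt
  refine ⟨?_, ?_, ?_⟩
  · rw [hQt, ← mul_assoc, ENNReal.mul_inv_cancel hI0 hItop, one_mul]
  · rw [hQt]
    exact ENNReal.mul_ne_top (ENNReal.inv_ne_top.2 hI0) (measure_ne_top _ _)
  · rw [hQt, ENNReal.div_eq_inv_mul]
end

section
/- Palm–Khinchin equation relating entry and return time distributions: let 𝔓 be a stationary simple point process on ℝ with intensity I ∈ (0,∞) and Palm distribution Q. Then for every R ≥ 0, 𝔓({ζ : ζ ≠ 0 and τ₁(ζ) > R}) = I · ∫_R^∞ Q({η : τ₁(η) > u}) du. -/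
open MeasureTheory Set Filter
open scoped ENNReal

namespace PK

def Good (ζ : Measure ℝ) : Prop :=
  (∀ B : Set ℝ, Bornology.IsBounded B → MeasurableSet B → ∃ n : ℕ, ζ B = (n : ℝ≥0∞)) ∧
    ∀ t : ℝ, ζ ({t} : Set ℝ) ≤ 1

def T (u : ℝ) : Set (Measure ℝ) := {η | ENNReal.ofReal u < tau 1 η}

lemma T_eq (u : ℝ) (hu : 0 ≤ u) :
    T u = ⋃ v : ℚ, ⋃ _ : u < (v : ℝ), {η : Measure ℝ | η (Ioc 0 (v : ℝ)) < 1} := by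
  ext η
  simp only [T, tau, mem_ofPred_eq, mem_iUnion, exists_prop, one_ne_zero, if_false, Nat.cast_one]
  constructor
  · intro h
    obtain ⟨w, hw1, hw2⟩ := ENNReal.lt_iff_exists_nnreal_btwn.1 h
    have hw1' : u < (w : ℝ) := by
      rw [← ENNReal.ofReal_coe_nnreal] at hw1
      exact (ENNReal.ofReal_lt_ofReal_iff_of_nonneg hu).1 hw1
    obtain ⟨v, hv1, hv2⟩ := exists_rat_btwn hw1'
    refine ⟨v, hv1, ?_⟩
    by_contra hcon
    push Not at hcon
    have : sInf ((fun s : ℝ => ENNReal.ofReal s) '' {s : ℝ | 0 < s ∧ 1 ≤ η (Set.Ioc 0 s)})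
        ≤ ENNReal.ofReal v := sInf_le ⟨v, ⟨hu.trans_lt hv1, hcon⟩, rfl⟩
    have h2 : ENNReal.ofReal v ≤ w := by
      rw [← ENNReal.ofReal_coe_nnreal]; exact ENNReal.ofReal_le_ofReal hv2.le
    exact absurd (hw2.trans_le (this.trans h2)) (lt_irrefl _)
  · rintro ⟨v, hv, hlt⟩
    refine lt_of_lt_of_le ((ENNReal.ofReal_lt_ofReal_iff_of_nonneg hu).2 hv) ?_
    apply le_sInf
    rintro _ ⟨s, ⟨hs0, hs⟩, rfl⟩
    apply ENNReal.ofReal_le_ofReal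
    by_contra hc
    push Not at hc
    exact absurd (hs.trans (measure_mono (Ioc_subset_Ioc_right hc.le))) (not_le.2 hlt)

lemma measurableSet_T (u : ℝ) (hu : 0 ≤ u) : MeasurableSet (T u) := by
  rw [T_eq u hu]
  refine MeasurableSet.iUnion fun v => MeasurableSet.iUnion fun _ => ?_
  exact measurableSet_lt (Measure.measurable_coe measurableSet_Ioc) measurable_const

lemma T_anti {u v : ℝ} (h : u ≤ v) : T v ⊆ T u := fun _ hη =>
  lt_of_le_of_lt (ENNReal.ofReal_le_ofReal h) hη

lemma shift_apply (z : ℝ) (ζ : Measure ℝ) (B : Set ℝ) :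
    shift z ζ B = ζ ((fun t => t - z) ⁻¹' B) :=
  (MeasurableEquiv.subRight z).map_apply B

lemma shift_Ioc (z : ℝ) (ζ : Measure ℝ) (a b : ℝ) :
    shift z ζ (Ioc a b) = ζ (Ioc (a + z) (b + z)) := by
  rw [shift_apply]; congr 1; ext x; simp

lemma shift_shift (x z : ℝ) (ζ : Measure ℝ) : shift x (shift z ζ) = shift (x + z) ζ := by
  ext B _
  rw [shift_apply, shift_apply, shift_apply]; congr 1; ext t; simp [sub_sub, add_comm]

lemma measurable_shift (z : ℝ) : Measurable (shift z) :=
  Measure.measurable_map _ (by fun_prop)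

lemma Good.finite {ζ : Measure ℝ} (h : Good ζ) {B : Set ℝ} (hB : Bornology.IsBounded B) :
    ζ B ≠ ⊤ := by
  obtain ⟨r, hr⟩ := hB.subset_closedBall 0
  obtain ⟨n, hn⟩ := h.1 (Metric.closedBall 0 r) Metric.isBounded_closedBall measurableSet_closedBall
  exact ne_top_of_le_ne_top (by rw [hn]; simp) (measure_mono hr)

lemma Good.lt_one {ζ : Measure ℝ} (h : Good ζ) {a b : ℝ} (hlt : ζ (Ioc a b) < 1) :
    ζ (Ioc a b) = 0 := by
  obtain ⟨n, hn⟩ := h.1 (Ioc a b) (Metric.isBounded_Ioc a b) measurableSet_Ioc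
  rw [hn] at hlt ⊢
  have : n < 1 := by exact_mod_cast hlt
  simp; omega

lemma Good.one_le {ζ : Measure ℝ} (h : Good ζ) {a b : ℝ} (hne : ζ (Ioc a b) ≠ 0) :
    1 ≤ ζ (Ioc a b) := by
  by_contra hc
  exact hne (h.lt_one (not_le.1 hc))

/-- right continuity -/
lemma Good.right {ζ : Measure ℝ} (h : Good ζ) {a b : ℝ} (h0 : ζ (Ioc a b) = 0) :
    ∃ c > b, ζ (Ioc a c) = 0 := by
  obtain ⟨u, hu, hu1, hu2⟩ := exists_seq_strictAnti_tendsto b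
  have hI : ⋂ n, Ioc a (u n) = Ioc a b := by
    ext x
    simp only [mem_iInter, mem_Ioc]
    constructor
    · intro hx
      exact ⟨(hx 0).1, ge_of_tendsto' hu2 fun n => (hx n).2⟩
    · intro hx n
      exact ⟨hx.1, hx.2.trans (hu1 n).le⟩
  have ht : Tendsto (fun n => ζ (Ioc a (u n))) atTop (nhds (ζ (⋂ n, Ioc a (u n)))) := by
    apply tendsto_measure_iInter_atTop
    · exact fun n => measurableSet_Ioc.nullMeasurableSet
    · exact fun m n hmn => Ioc_subset_Ioc_right (hu.antitone hmn)
    · exact ⟨0, h.finite (Metric.isBounded_Ioc _ _)⟩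
  rw [hI, h0] at ht
  obtain ⟨n, hn⟩ := (ht.eventually (gt_mem_nhds (zero_lt_one))).exists
  exact ⟨u n, hu1 n, h.lt_one hn⟩

lemma Good.mem_T {ζ : Measure ℝ} (h : Good ζ) (x u : ℝ) (hu : 0 ≤ u) :
    shift x ζ ∈ T u ↔ ζ (Ioc x (x + u)) = 0 := by
  rw [T_eq u hu]
  simp only [mem_iUnion, exists_prop, mem_ofPred_eq, shift_Ioc, zero_add]
  constructor
  · rintro ⟨v, hv, hlt⟩
    refine measure_mono_null (Ioc_subset_Ioc_right ?_) (h.lt_one hlt)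
    linarith
  · intro h0
    obtain ⟨c, hc, hc0⟩ := h.right h0
    obtain ⟨v, hv1, hv2⟩ := exists_rat_btwn (show u < c - x by linarith)
    refine ⟨v, hv1, ?_⟩
    rw [measure_mono_null (Ioc_subset_Ioc_right (by linarith)) hc0]
    exact zero_lt_one

/-- the last point -/
lemma Good.last {ζ : Measure ℝ} (h : Good ζ) {a b : ℝ} (hne : ζ (Ioc a b) ≠ 0) :
    ∃ x ∈ Ioc a b, ζ {x} = 1 ∧ ζ (Ioc x b) = 0 ∧ ∀ y < x, ζ (Ioc y b) ≠ 0 := by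
  set A : Set ℝ := {x | x ≤ b ∧ ζ (Ioc x b) ≠ 0} with hA
  have hab : a ≤ b := by
    by_contra hc
    exact hne (by rw [Ioc_eq_empty (by linarith)]; simp)
  have haA : a ∈ A := ⟨hab, hne⟩
  have hbd : BddAbove A := ⟨b, fun x hx => hx.1⟩
  set x0 := sSup A with hx0
  have hx0b : x0 ≤ b := csSup_le ⟨a, haA⟩ fun x hx => hx.1
  have hlt : ∀ y < x0, ζ (Ioc y b) ≠ 0 := by
    intro y hy h0
    obtain ⟨z, hz, hyz⟩ := exists_lt_of_lt_csSup ⟨a, haA⟩ hy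
    exact hz.2 (measure_mono_null (Ioc_subset_Ioc_left hyz.le) h0)
  have hzero : ζ (Ioc x0 b) = 0 := by
    obtain ⟨u, hu, hu1, hu2⟩ := exists_seq_strictAnti_tendsto x0
    have : Ioc x0 b ⊆ ⋃ n, Ioc (u n) b := by
      intro y hy
      obtain ⟨n, hn⟩ := (hu2.eventually (gt_mem_nhds hy.1)).exists
      exact mem_iUnion.2 ⟨n, hn, hy.2⟩
    refine measure_mono_null this (measure_iUnion_null fun n => ?_)
    by_contra hc
    by_cases hb : u n ≤ b
    · exact absurd (le_csSup hbd (show u n ∈ A from ⟨hb, hc⟩)) (not_le.2 (hu1 n))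
    · exact hc (by rw [Ioc_eq_empty (by linarith)]; simp)
  have hax : a < x0 := by
    rcases (le_csSup hbd haA).lt_or_eq with h1 | h1
    · exact h1
    · exfalso; apply hne
      have : a = x0 := h1
      rw [this]; exact hzero
  have hone : 1 ≤ ζ {x0} := by
    obtain ⟨u, hu, hu1, hu2⟩ := exists_seq_strictMono_tendsto x0
    have hI : ⋂ n, Ioc (u n) b = Icc x0 b := by
      ext x
      simp only [mem_iInter, mem_Ioc, mem_Icc]
      constructor
      · intro hx
        exact ⟨le_of_tendsto' hu2 fun n => (hx n).1.le, (hx 0).2⟩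
      · intro hx n
        exact ⟨(hu1 n).trans_le hx.1, hx.2⟩
    have ht : Tendsto (fun n => ζ (Ioc (u n) b)) atTop (nhds (ζ (⋂ n, Ioc (u n) b))) := by
      apply tendsto_measure_iInter_atTop
      · exact fun n => measurableSet_Ioc.nullMeasurableSet
      · exact fun m n hmn => Ioc_subset_Ioc_left (hu.monotone hmn)
      · exact ⟨0, h.finite (Metric.isBounded_Ioc _ _)⟩
    rw [hI] at ht
    have h1 : 1 ≤ ζ (Icc x0 b) := ge_of_tendsto' ht fun n => h.one_le (hlt _ (hu1 n))
    have h2 : ζ (Icc x0 b) ≤ ζ {x0} + ζ (Ioc x0 b) := by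
      refine (measure_mono ?_).trans (measure_union_le _ _)
      intro y hy
      rcases hy.1.eq_or_lt with h3 | h3
      · left; exact h3.symm
      · right; exact ⟨h3, hy.2⟩
    rw [hzero, add_zero] at h2
    exact h1.trans h2
  exact ⟨x0, ⟨hax, hx0b⟩, le_antisymm (h.2 x0) hone, hzero, hlt⟩

noncomputable def F (u a b : ℝ) (ζ : Measure ℝ) : ℝ≥0∞ := ζ (Ioc a b ∩ {x | shift x ζ ∈ T u})

lemma F_shift (u a b z : ℝ) (ζ : Measure ℝ) : F u a b (shift z ζ) = F u (a + z) (b + z) ζ := by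
  unfold F
  rw [shift_apply]
  congr 1
  ext x
  simp [shift_shift]

/-- jointly measurable version of the event -/
def E (u : ℝ) : Set (Measure ℝ × ℝ) :=
  ⋃ v : ℚ, ⋃ _ : u < (v : ℝ), ⋂ p : ℚ, ⋂ q : ℚ,
    ({z | z.2 < p ∧ (q : ℝ) < z.2 + v}ᶜ ∪ {z | z.1 (Ioc (p : ℝ) q) = 0})

lemma measurableSet_E (u : ℝ) : MeasurableSet (E u) := by
  refine MeasurableSet.iUnion fun v => MeasurableSet.iUnion fun _ => MeasurableSet.iInter fun p =>
    MeasurableSet.iInter fun q => MeasurableSet.union (MeasurableSet.compl ?_) ?_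
  · exact (measurableSet_lt measurable_snd measurable_const).inter
      (measurableSet_lt measurable_const (measurable_snd.add_const _))
  · exact ((Measure.measurable_coe measurableSet_Ioc).comp measurable_fst) (measurableSet_singleton 0)

lemma Good.mem_E {ζ : Measure ℝ} (h : Good ζ) (x u : ℝ) (hu : 0 ≤ u) :
    (ζ, x) ∈ E u ↔ shift x ζ ∈ T u := by
  rw [h.mem_T x u hu]
  simp only [E, mem_iUnion, mem_iInter, exists_prop, mem_union, mem_compl_iff, mem_ofPred_eq]
  constructor
  · rintro ⟨v, hv, H⟩
    have : Ioc x (x + u) ⊆ ⋃ r : {r : ℚ × ℚ // x < r.1 ∧ (r.2 : ℝ) < x + v},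
        Ioc (r.1.1 : ℝ) r.1.2 := by
      intro y hy
      obtain ⟨p, hp1, hp2⟩ := exists_rat_btwn hy.1
      obtain ⟨q, hq1, hq2⟩ := exists_rat_btwn (show y < x + v by linarith [hy.2])
      exact mem_iUnion.2 ⟨⟨(p, q), hp1, hq2⟩, hp2, hq1.le⟩
    refine measure_mono_null this (measure_iUnion_null ?_)
    rintro ⟨⟨p, q⟩, hp, hq⟩
    rcases H p q with h1 | h1
    · exact absurd ⟨hp, hq⟩ h1
    · exact h1
  · intro h0
    obtain ⟨c, hc, hc0⟩ := h.right h0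
    obtain ⟨v, hv1, hv2⟩ := exists_rat_btwn (show u < c - x by linarith)
    refine ⟨v, hv1, fun p q => ?_⟩
    by_cases hpq : x < p ∧ (q : ℝ) < x + v
    · right
      exact measure_mono_null (Ioc_subset_Ioc hpq.1.le (by linarith [hpq.2])) hc0
    · left; exact hpq

lemma Good.measurableSet {ζ : Measure ℝ} (h : Good ζ) (u : ℝ) (hu : 0 ≤ u) :
    MeasurableSet {x | shift x ζ ∈ T u} := by
  have : {x | shift x ζ ∈ T u} = Prod.mk ζ ⁻¹' E u := by
    ext x; exact (h.mem_E x u hu).symm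
  rw [this]
  exact measurable_prodMk_left (measurableSet_E u)

lemma aemeasurable_F (P : Measure (Measure ℝ)) (hP : ∀ᵐ ζ ∂P, Good ζ) (u a b : ℝ) (hu : 0 ≤ u) :
    AEMeasurable (F u a b) P := by
  classical
  have hev : Measurable fun ζ : Measure ℝ => ζ (Ioc a b) := Measure.measurable_coe measurableSet_Ioc
  let κ : ProbabilityTheory.Kernel (Measure ℝ) ℝ :=
    { toFun := fun ζ => (ζ (Ioc a b))⁻¹ • ζ.restrict (Ioc a b)
      measurable' := by
        refine Measure.measurable_of_measurable_coe _ fun s hs => ?_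
        simp only [Measure.smul_apply, smul_eq_mul, Measure.restrict_apply hs]
        exact hev.inv.mul (Measure.measurable_coe (hs.inter measurableSet_Ioc)) }
  have hfin : ProbabilityTheory.IsFiniteKernel κ := by
    refine ⟨⟨1, ENNReal.one_lt_top, fun ζ => ?_⟩⟩
    change (((ζ (Ioc a b))⁻¹ • ζ.restrict (Ioc a b) : Measure ℝ)) univ ≤ 1
    simp only [Measure.smul_apply, smul_eq_mul, Measure.restrict_apply MeasurableSet.univ, univ_inter]
    exact ENNReal.inv_mul_le_one _
  have hm : Measurable fun ζ => κ ζ (Prod.mk ζ ⁻¹' E u) :=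
    ProbabilityTheory.Kernel.measurable_kernel_prodMk_left (measurableSet_E u)
  refine ⟨fun ζ => ζ (Ioc a b) * κ ζ (Prod.mk ζ ⁻¹' E u), hev.mul hm, ?_⟩
  filter_upwards [hP] with ζ h
  change F u a b ζ = ζ (Ioc a b) *
    ((ζ (Ioc a b))⁻¹ • ζ.restrict (Ioc a b) : Measure ℝ) (Prod.mk ζ ⁻¹' E u)
  have hset : {x | shift x ζ ∈ T u} = Prod.mk ζ ⁻¹' E u := by
    ext x; exact (h.mem_E x u hu).symm
  rw [Measure.smul_apply, Measure.restrict_apply (measurable_prodMk_left (measurableSet_E u)), F,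
    hset, smul_eq_mul, inter_comm]
  by_cases h0 : ζ (Ioc a b) = 0
  · rw [h0, zero_mul]; exact measure_mono_null inter_subset_right h0
  · rw [← mul_assoc, ENNReal.mul_inv_cancel h0 (h.finite (Metric.isBounded_Ioc _ _)), one_mul]

section main
variable {P : Measure (Measure ℝ)} 

noncomputable def M (P : Measure (Measure ℝ)) (u a b : ℝ) : ℝ≥0∞ := ∫⁻ ζ, F u a b ζ ∂P

lemma M_shift (hstat : IsStationaryPP P) (hP : ∀ᵐ ζ ∂P, Good ζ) (u a b z : ℝ) (hu : 0 ≤ u) :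
    M P u (a + z) (b + z) = M P u a b := by
  unfold M
  simp_rw [← F_shift]
  have h := aemeasurable_F P hP u a b hu
  conv_rhs => rw [← hstat z]
  rw [lintegral_map' (by rw [hstat z]; exact h) (measurable_shift z).aemeasurable]

lemma M_add (hP : ∀ᵐ ζ ∂P, Good ζ) (u a b c : ℝ) (hu : 0 ≤ u) (hab : a ≤ b)
    (hbc : b ≤ c) : M P u a c = M P u a b + M P u b c := by
  unfold M
  rw [← lintegral_add_left' (aemeasurable_F P hP u a b hu)]
  apply lintegral_congr_ae
  filter_upwards [hP] with ζ h
  have hm := h.measurableSet u hu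
  unfold F
  rw [← Ioc_union_Ioc_eq_Ioc hab hbc, union_inter_distrib_right, measure_union]
  · exact (Ioc_disjoint_Ioc_of_le le_rfl).mono inter_subset_left inter_subset_left
  · exact measurableSet_Ioc.inter hm

lemma M_nsmul (hstat : IsStationaryPP P) (hP : ∀ᵐ ζ ∂P, Good ζ) (u h : ℝ) (hu : 0 ≤ u)
    (hh : 0 ≤ h) (k : ℕ) : M P u 0 (k * h) = k * M P u (-h) 0 := by
  induction k with
  | zero => simp [M, F]
  | succ k ih =>
    rw [M_add hP u 0 (k * h) _ hu (by positivity) (by push_cast; nlinarith), ih]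
    have := M_shift hstat hP u (-h) 0 ((k + 1) * h) hu
    push_cast
    rw [show -h + (k + 1) * h = k * h by ring, zero_add] at this
    rw [this, add_mul, one_mul]

lemma palm_eq {Q : Measure (Measure ℝ)} (hP : ∀ᵐ ζ ∂P, Good ζ) 
    (hI0 : intensity P ≠ 0) (hItop : intensity P ≠ ⊤)
    (hQ : IsPalm P Q) (u : ℝ) (hu : 0 ≤ u) : intensity P * Q (T u) = M P u 0 1 := by
  have h := hQ ((T u).indicator 1) (measurable_one.indicator (measurableSet_T u hu))
  rw [lintegral_indicator_one (measurableSet_T u hu)] at h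
  rw [h, ← mul_assoc, ENNReal.mul_inv_cancel hI0 hItop, one_mul]
  apply lintegral_congr_ae
  filter_upwards [hP] with ζ hζ
  have hm := hζ.measurableSet u hu
  have : (fun x => (T u).indicator (1 : Measure ℝ → ℝ≥0∞) (shift x ζ))
      = ({x | shift x ζ ∈ T u}).indicator 1 := by
    ext x; simp [indicator]
  rw [this, lintegral_indicator_one hm, Measure.restrict_apply hm, F, inter_comm]

lemma palm_step {Q : Measure (Measure ℝ)} (hstat : IsStationaryPP P) (hP : ∀ᵐ ζ ∂P, Good ζ) 
    (hI0 : intensity P ≠ 0) (hItop : intensity P ≠ ⊤)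
    (hQ : IsPalm P Q) (u : ℝ) (hu : 0 ≤ u) (n : ℕ) (hn : 0 < n) :
    M P u (-(n : ℝ)⁻¹) 0 = ENNReal.ofReal (n : ℝ)⁻¹ * (intensity P * Q (T u)) := by
  rw [palm_eq hP hI0 hItop hQ u hu]
  have h := M_nsmul hstat hP u (n : ℝ)⁻¹ hu (by positivity) n
  rw [mul_inv_cancel₀ (by positivity)] at h
  rw [h, ENNReal.ofReal_inv_of_pos (by positivity), ENNReal.ofReal_natCast, ← mul_assoc,
    ENNReal.inv_mul_cancel (by simp; omega) (by simp), one_mul]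

noncomputable def D (P : Measure (Measure ℝ)) (R : ℝ) : ℝ≥0∞ := P {ζ | ζ (Ioc 0 R) = 0}

lemma measurableSet_null (B : Set ℝ) (hB : MeasurableSet B) :
    MeasurableSet {ζ : Measure ℝ | ζ B = 0} :=
  (Measure.measurable_coe hB) (measurableSet_singleton 0)

lemma D_shift (hstat : IsStationaryPP P) (R h : ℝ) :
    P {ζ | ζ (Ioc (-h) R) = 0} = D P (R + h) := by
  conv_lhs => rw [← hstat h]
  rw [Measure.map_apply (measurable_shift h) (measurableSet_null _ measurableSet_Ioc), D]
  congr 1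
  ext ζ
  simp [shift_Ioc]

lemma upper (hstat : IsStationaryPP P) (hP : ∀ᵐ ζ ∂P, Good ζ) (R h : ℝ) (hR : 0 ≤ R) :
    D P R ≤ D P (R + h) + M P R (-h) 0 := by
  rw [← D_shift hstat, D, M, ← lintegral_indicator_one (measurableSet_null _ measurableSet_Ioc),
    ← lintegral_indicator_one (measurableSet_null _ measurableSet_Ioc),
    ← lintegral_add_right' _ (aemeasurable_F P hP _ _ _ hR)]
  apply lintegral_mono_ae
  filter_upwards [hP] with ζ hζ
  by_cases h1 : ζ (Ioc 0 R) = 0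
  swap
  · simp [indicator, h1]
  by_cases h2 : ζ (Ioc (-h) R) = 0
  · simp [indicator, h1, h2]
  simp only [indicator, mem_ofPred_eq, h1, h2, if_true, if_false, Pi.one_apply, zero_add]
  have h3 : ζ (Ioc (-h) 0) ≠ 0 := by
    intro h0
    refine h2 (measure_mono_null ?_ (measure_union_null h0 h1))
    intro x hx
    rcases le_or_gt x 0 with h4 | h4
    · left; exact ⟨hx.1, h4⟩
    · right; exact ⟨h4, hx.2⟩
  obtain ⟨x, hx, hx1, hx0, -⟩ := hζ.last h3
  rw [← hx1]
  refine measure_mono (singleton_subset_iff.2 ⟨hx, ?_⟩)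
  rw [mem_ofPred_eq, hζ.mem_T _ _ hR]
  refine measure_mono_null ?_ (measure_union_null hx0 h1)
  intro y hy
  rcases le_or_gt y 0 with h4 | h4
  · left; exact ⟨hy.1, h4⟩
  · right; exact ⟨h4, by linarith [hy.2, hx.2]⟩

lemma lower (hstat : IsStationaryPP P) (hP : ∀ᵐ ζ ∂P, Good ζ) (R h : ℝ) (hR : 0 ≤ R) (hh : 0 ≤ h) :
    D P (R + h) + M P (R + h) (-h) 0 ≤ D P R := by
  have hRh : 0 ≤ R + h := by positivity
  rw [← D_shift hstat, D, M, ← lintegral_indicator_one (measurableSet_null _ measurableSet_Ioc),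
    ← lintegral_indicator_one (measurableSet_null _ measurableSet_Ioc),
    ← lintegral_add_right' _ (aemeasurable_F P hP _ _ _ hRh)]
  apply lintegral_mono_ae
  filter_upwards [hP] with ζ hζ
  by_cases h2 : ζ (Ioc (-h) R) = 0
  · have h1 : ζ (Ioc 0 R) = 0 := measure_mono_null (Ioc_subset_Ioc_left (by linarith)) h2
    have h3 : F (R + h) (-h) 0 ζ = 0 :=
      measure_mono_null (inter_subset_left.trans (Ioc_subset_Ioc_right hR)) h2
    simp [indicator, h1, h2, h3]
  simp only [indicator, mem_ofPred_eq, h2, if_false, zero_add]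
  have key : ∀ x ∈ Ioc (-h) 0 ∩ {x | shift x ζ ∈ T (R + h)}, ζ (Ioc x R) = 0 := by
    rintro x ⟨hx, hxT⟩
    rw [mem_ofPred_eq, hζ.mem_T _ _ hRh] at hxT
    exact measure_mono_null (Ioc_subset_Ioc_right (by linarith [hx.1])) hxT
  by_cases h1 : ζ (Ioc 0 R) = 0
  · simp only [h1, if_true, Pi.one_apply]
    by_cases h3 : ζ (Ioc (-h) 0) = 0
    · rw [F, measure_mono_null inter_subset_left h3]; exact zero_le
    obtain ⟨x, hx, hx1, hx0, hxl⟩ := hζ.last h3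
    calc F (R + h) (-h) 0 ζ ≤ ζ ({x} ∪ Ioc x 0) := by
          apply measure_mono
          intro y hy
          rcases lt_trichotomy y x with h4 | h4 | h4
          · exact absurd (measure_mono_null (Ioc_subset_Ioc_right hR) (key y hy)) (hxl y h4)
          · left; exact h4
          · right; exact ⟨h4, hy.1.2⟩
      _ ≤ ζ {x} + ζ (Ioc x 0) := measure_union_le _ _
      _ = 1 := by rw [hx1, hx0, add_zero]
  · have : Ioc (-h) 0 ∩ {x | shift x ζ ∈ T (R + h)} = ∅ := by
      by_contra hne
      obtain ⟨x, hx⟩ := nonempty_iff_ne_empty.2 hne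
      exact h1 (measure_mono_null (Ioc_subset_Ioc_left hx.1.2) (key x hx))
    rw [F, this]; simp

lemma zero_eq : {ζ : Measure ℝ | ζ = 0} = ⋂ m : ℕ, {ζ : Measure ℝ | ζ (Ioi (-(m : ℝ))) = 0} := by
  ext ζ
  simp only [mem_ofPred_eq, mem_iInter]
  constructor
  · rintro rfl; simp
  · intro h
    rw [← Measure.measure_univ_eq_zero]
    refine measure_mono_null ?_ (measure_iUnion_null h)
    intro x _
    obtain ⟨m, hm⟩ := exists_nat_gt (-x)
    exact mem_iUnion.2 ⟨m, by simp only [mem_Ioi]; linarith⟩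

lemma measurableSet_zero : MeasurableSet {ζ : Measure ℝ | ζ = 0} := by
  rw [zero_eq]
  exact MeasurableSet.iInter fun m => measurableSet_null _ measurableSet_Ioi

lemma P_zero [IsProbabilityMeasure P] (hstat : IsStationaryPP P) :
    P {ζ | ζ = 0} = P {ζ | ζ (Ioi 0) = 0} := by
  have ht : Tendsto (fun m : ℕ => P {ζ : Measure ℝ | ζ (Ioi (-(m : ℝ))) = 0}) atTop
      (nhds (P {ζ | ζ = 0})) := by
    rw [zero_eq]
    apply tendsto_measure_iInter_atTop
    · exact fun n => (measurableSet_null _ measurableSet_Ioi).nullMeasurableSet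
    · intro m n hmn ζ hζ
      refine measure_mono_null (Ioi_subset_Ioi ?_) hζ
      have : (m : ℝ) ≤ n := by exact_mod_cast hmn
      linarith
    · exact ⟨0, measure_ne_top _ _⟩
  have hc : ∀ m : ℕ, P {ζ : Measure ℝ | ζ (Ioi (-(m : ℝ))) = 0} = P {ζ | ζ (Ioi 0) = 0} := by
    intro m
    conv_lhs => rw [← hstat m]
    rw [Measure.map_apply (measurable_shift _) (measurableSet_null _ measurableSet_Ioi)]
    congr 1
    ext ζ
    have : (fun t : ℝ => t - m) ⁻¹' Ioi (-(m : ℝ)) = Ioi 0 := by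
      ext t; simp
    simp [shift_apply, this]
  simp_rw [hc] at ht
  exact tendsto_nhds_unique ht tendsto_const_nhds

lemma D_tendsto [IsProbabilityMeasure P] (hstat : IsStationaryPP P) (R h : ℝ) (hh : 0 < h) :
    Tendsto (fun k : ℕ => D P (R + k * h)) atTop (nhds (P {ζ | ζ = 0})) := by
  rw [P_zero hstat]
  have : {ζ : Measure ℝ | ζ (Ioi 0) = 0} = ⋂ k : ℕ, {ζ | ζ (Ioc 0 (R + k * h)) = 0} := by
    ext ζ
    simp only [mem_ofPred_eq, mem_iInter]
    constructor
    · exact fun h0 k => measure_mono_null Ioc_subset_Ioi_self h0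
    · intro h0
      refine measure_mono_null ?_ (measure_iUnion_null h0)
      intro x hx
      obtain ⟨k, hk⟩ := exists_nat_gt ((x - R) / h)
      rw [div_lt_iff₀ hh] at hk
      exact mem_iUnion.2 ⟨k, hx, by linarith⟩
  rw [this]
  apply tendsto_measure_iInter_atTop
  · exact fun n => (measurableSet_null _ measurableSet_Ioc).nullMeasurableSet
  · intro m n hmn ζ hζ
    refine measure_mono_null (Ioc_subset_Ioc_right ?_) hζ
    have : (m : ℝ) ≤ n := by exact_mod_cast hmn
    nlinarith
  · exact ⟨0, measure_ne_top _ _⟩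

noncomputable def mu (Q : Measure (Measure ℝ)) : Measure ℝ :=
  (volume : Measure ℝ).withDensity fun u => Q (T u)

lemma mu_le (Q : Measure (Measure ℝ)) (R h : ℝ) :
    mu Q (Ioc R (R + h)) ≤ ENNReal.ofReal h * Q (T R) := by
  rw [mu, withDensity_apply _ measurableSet_Ioc]
  calc ∫⁻ u in Ioc R (R + h), Q (T u) ≤ ∫⁻ _ in Ioc R (R + h), Q (T R) :=
        setLIntegral_mono measurable_const fun u hu => measure_mono (T_anti hu.1.le)
    _ = ENNReal.ofReal h * Q (T R) := by
        rw [setLIntegral_const, Real.volume_Ioc, mul_comm]; congr 2; ring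

lemma le_mu (Q : Measure (Measure ℝ)) (R h : ℝ) :
    ENNReal.ofReal h * Q (T (R + h)) ≤ mu Q (Ioc R (R + h)) := by
  rw [mu, withDensity_apply _ measurableSet_Ioc]
  calc ENNReal.ofReal h * Q (T (R + h)) = ∫⁻ _ in Ioc R (R + h), Q (T (R + h)) := by
        rw [setLIntegral_const, Real.volume_Ioc, mul_comm]; congr 2; ring
    _ ≤ ∫⁻ u in Ioc R (R + h), Q (T u) :=
        setLIntegral_mono' measurableSet_Ioc fun u hu => measure_mono (T_anti hu.2)

lemma mu_split (ν : Measure ℝ) (a b c : ℝ) (hab : a ≤ b) (hbc : b ≤ c) :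
    ν (Ioc a c) = ν (Ioc a b) + ν (Ioc b c) := by
  rw [← Ioc_union_Ioc_eq_Ioc hab hbc,
    measure_union (Ioc_disjoint_Ioc_of_le le_rfl) measurableSet_Ioc]

lemma mu_Ioi (ν : Measure ℝ) (a h : ℝ) (hh : 0 < h) :
    Tendsto (fun k : ℕ => ν (Ioc a (a + k * h))) atTop (nhds (ν (Ioi a))) := by
  have : Ioi a = ⋃ k : ℕ, Ioc a (a + k * h) := by
    ext x
    simp only [mem_iUnion, mem_Ioc, mem_Ioi, exists_and_left]
    refine ⟨fun hx => ⟨hx, ?_⟩, fun hx => hx.1⟩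
    obtain ⟨k, hk⟩ := exists_nat_gt ((x - a) / h)
    rw [div_lt_iff₀ hh] at hk
    exact ⟨k, by linarith⟩
  rw [this]
  apply tendsto_measure_iUnion_atTop
  intro m n hmn
  refine Ioc_subset_Ioc_right ?_
  have : (m : ℝ) ≤ n := by exact_mod_cast hmn
  nlinarith

lemma D_eq {Q : Measure (Measure ℝ)} [IsProbabilityMeasure P] [IsProbabilityMeasure Q]
    (hstat : IsStationaryPP P) (hP : ∀ᵐ ζ ∂P, Good ζ)
    (hI0 : intensity P ≠ 0) (hItop : intensity P ≠ ⊤)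
    (hQ : IsPalm P Q) (R : ℝ) (hR : 0 ≤ R) :
    D P R = P {ζ | ζ = 0} + intensity P * mu Q (Ioi R) := by
  set I := intensity P with hI
  set p0 := P {ζ : Measure ℝ | ζ = 0} with hp0
  have hstep := fun u hu n hn => palm_step hstat hP hI0 hItop hQ u hu n hn
  -- error term
  have herr : Tendsto (fun n : ℕ => ENNReal.ofReal ((n : ℝ))⁻¹ * I) atTop (nhds 0) := by
    have h1 : Tendsto (fun n : ℕ => ENNReal.ofReal ((n : ℝ))⁻¹) atTop (nhds 0) := by
      have := ENNReal.tendsto_ofReal (tendsto_inv_atTop_nhds_zero_nat (𝕜 := ℝ))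
      simpa using this
    have := ENNReal.Tendsto.mul_const h1 (Or.inr hItop)
    simpa using this
  have up : ∀ n : ℕ, 0 < n → D P R ≤ (p0 + I * mu Q (Ioi R)) + ENNReal.ofReal ((n : ℝ))⁻¹ * I := by
    intro n hn
    set h : ℝ := (n : ℝ)⁻¹ with hh
    have hpos : 0 < h := by positivity
    have s1 : D P R ≤ D P (R + h) + ENNReal.ofReal h * I := by
      refine (upper hstat hP R h hR).trans ?_
      rw [hstep R hR n hn]
      gcongr
      exact mul_le_of_le_one_right' prob_le_one
    have tel : ∀ k : ℕ, D P (R + h) ≤ D P (R + h + k * h) + I * mu Q (Ioc R (R + k * h)) := by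
      intro k
      induction k with
      | zero => simp
      | succ k ih =>
        refine ih.trans ?_
        have hk : 0 ≤ (k : ℝ) * h := by positivity
        have h1 := upper hstat hP (R + h + k * h) h (by positivity)
        rw [hstep _ (by positivity) n hn] at h1
        have h2 := le_mu Q (R + k * h) h
        rw [mu_split (mu Q) R (R + k * h) (R + (k + 1 : ℕ) * h) (by linarith)
          (by push_cast; nlinarith)]
        rw [show R + h + ((k + 1 : ℕ) : ℝ) * h = R + h + k * h + h by push_cast; ring,
          show R + ((k + 1 : ℕ) : ℝ) * h = R + k * h + h by push_cast; ring]
        rw [show R + k * h + h = R + h + k * h by ring] at h2 ⊢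
        calc D P (R + h + k * h) + I * mu Q (Ioc R (R + k * h))
            ≤ (D P (R + h + k * h + h) + I * mu Q (Ioc (R + k * h) (R + h + k * h)))
              + I * mu Q (Ioc R (R + k * h)) := by
              gcongr
              refine h1.trans ?_
              rw [mul_left_comm]
              gcongr
          _ = _ := by rw [mul_add, add_assoc, add_comm (I * mu Q (Ioc (R + k * h) _))]
    have s2 : D P (R + h) ≤ p0 + I * mu Q (Ioi R) := by
      refine ge_of_tendsto' ((D_tendsto hstat (R + h) h hpos).add_const _) fun k => ?_
      refine (tel k).trans ?_
      gcongr
      exact Ioc_subset_Ioi_self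
    exact s1.trans (by gcongr)
  have low : ∀ n : ℕ, 0 < n → p0 + I * mu Q (Ioi R) ≤ D P R + ENNReal.ofReal ((n : ℝ))⁻¹ * I := by
    intro n hn
    set h : ℝ := (n : ℝ)⁻¹ with hh
    have hpos : 0 < h := by positivity
    have tel : ∀ k : ℕ, D P (R + k * h) + I * mu Q (Ioc (R + h) (R + h + k * h)) ≤ D P R := by
      intro k
      induction k with
      | zero => simp
      | succ k ih =>
        refine le_trans ?_ ih
        have hk : 0 ≤ (k : ℝ) * h := by positivity
        have h1 := lower hstat hP (R + k * h) h (by positivity) hpos.le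
        rw [hstep _ (by positivity) n hn] at h1
        have h2 := mu_le Q (R + k * h + h) h
        rw [mu_split (mu Q) (R + h) (R + h + k * h) (R + h + (k + 1 : ℕ) * h) (by linarith)
          (by push_cast; nlinarith)]
        rw [show R + h + ((k + 1 : ℕ) : ℝ) * h = R + k * h + h + h by push_cast; ring,
          show R + ((k + 1 : ℕ) : ℝ) * h = R + k * h + h by push_cast; ring,
          show R + h + k * h = R + k * h + h by ring]
        calc D P (R + k * h + h) + I * (mu Q (Ioc (R + h) (R + k * h + h))
                + mu Q (Ioc (R + k * h + h) (R + k * h + h + h)))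
            = (D P (R + k * h + h) + I * mu Q (Ioc (R + k * h + h) (R + k * h + h + h)))
              + I * mu Q (Ioc (R + h) (R + k * h + h)) := by
              ring
          _ ≤ _ := by
              gcongr
              refine le_trans ?_ h1
              rw [mul_left_comm]
              gcongr
    have s2 : p0 + I * mu Q (Ioi (R + h)) ≤ D P R := by
      have t := (D_tendsto hstat R h hpos).add
        (ENNReal.Tendsto.const_mul (mu_Ioi (mu Q) (R + h) h hpos) (Or.inr hItop))
      exact le_of_tendsto' t tel
    have s3 : mu Q (Ioi R) ≤ mu Q (Ioi (R + h)) + ENNReal.ofReal h := by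
      rw [← Ioc_union_Ioi_eq_Ioi (show R ≤ R + h by linarith)]
      refine (measure_union_le _ _).trans ?_
      rw [add_comm (mu Q (Ioc R (R + h)))]
      gcongr
      exact (mu_le Q R h).trans (mul_le_of_le_one_right' prob_le_one)
    calc p0 + I * mu Q (Ioi R) ≤ p0 + I * (mu Q (Ioi (R + h)) + ENNReal.ofReal h) := by gcongr
      _ = (p0 + I * mu Q (Ioi (R + h))) + ENNReal.ofReal h * I := by
          rw [mul_add, add_assoc, mul_comm (ENNReal.ofReal h)]
      _ ≤ _ := by gcongr
  apply le_antisymm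
  · have t := herr.const_add (p0 + I * mu Q (Ioi R))
    rw [add_zero] at t
    exact ge_of_tendsto t ((eventually_gt_atTop 0).mono up)
  · have t := herr.const_add (D P R)
    rw [add_zero] at t
    exact ge_of_tendsto t ((eventually_gt_atTop 0).mono low)

end main
end PK

/-- Palm–Khinchin equation relating entry and return time distributions: for every `R ≥ 0`,
`𝔓({ζ : ζ ≠ 0 and τ₁(ζ) > R}) = I ∫_R^∞ Q({η : τ₁(η) > u}) du`. -/
theorem palm_khinchin
    (P Q : Measure (Measure ℝ)) [IsProbabilityMeasure P] [IsProbabilityMeasure Q]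
    (hstat : IsStationaryPP P) (hsimple : IsSimplePP P)
    (hI0 : intensity P ≠ 0) (hItop : intensity P ≠ ⊤)
    (hQ : IsPalm P Q) (R : ℝ) (hR : 0 ≤ R) :
    P {ζ : Measure ℝ | ζ ≠ 0 ∧ ENNReal.ofReal R < tau 1 ζ}
      = intensity P *
        ∫⁻ u in Set.Ioi R, Q {η : Measure ℝ | ENNReal.ofReal u < tau 1 η} ∂volume := by
  have hP : ∀ᵐ ζ ∂P, PK.Good ζ := hsimple
  have hD := PK.D_eq hstat hP hI0 hItop hQ R hR
  have hT : P (PK.T R) = PK.D P R := by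
    apply measure_congr
    filter_upwards [hP] with ζ hζ
    have h := hζ.mem_T 0 R hR
    have h0 : shift 0 ζ = ζ := by simp [shift]
    rw [h0, zero_add] at h
    exact propext h
  have hset : {ζ : Measure ℝ | ζ ≠ 0 ∧ ENNReal.ofReal R < tau 1 ζ}
      = PK.T R \ {ζ : Measure ℝ | ζ = 0} := by
    ext ζ
    exact and_comm
  have hsub : {ζ : Measure ℝ | ζ = 0} ⊆ PK.T R := by
    rintro ζ hζ
    have hζ' : ζ = 0 := hζ
    subst hζ'
    simp [PK.T, tau]
  rw [hset, measure_sdiff hsub PK.measurableSet_zero.nullMeasurableSet (measure_ne_top _ _), hT, hD,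
    ENNReal.add_sub_cancel_left (measure_ne_top _ _), PK.mu, withDensity_apply _ measurableSet_Ioi]
  rfl
end
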